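/- arXiv:2009.04079 — 7 statements merged into one kernel-verified Lean document; each statement's English description precedes it below -/
import Mathlib

section
/- Let (ξ_n)_{n≥1} be an exponentially mixing stationary process with values in a compact metric space X whose common distribution μ is Ahlfors s-regular, and let (h_n)_{n≥1} be a sequence of positive reals decreasing to 0. If the series ∑_{n=1}^∞ h_n^s diverges, then for every point y ∈ X one has ℙ(ξ_n ∈ B(y, h_n) for infinitely many n) = 1. -/
open MeasureTheory Metric Filter

/-- A Borel (probability) measure `μ` on a metric space is *Ahlfors `s`-regular* if there is a
constant `0 < C < ∞` with `C⁻¹ r^s ≤ μ (B(x,r)) ≤ C r^s` for all `x` and `0 < r ≤ diam X`. -/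
def IsAhlforsRegular {X : Type*} [MetricSpace X] [MeasurableSpace X]
    (μ : Measure X) (s : ℝ) : Prop :=
  ∃ C : ℝ, 0 < C ∧ ∀ (x : X) (r : ℝ), 0 < r → r ≤ diam (Set.univ : Set X) →
    ENNReal.ofReal (C⁻¹ * r ^ s) ≤ μ (ball x r) ∧ μ (ball x r) ≤ ENNReal.ofReal (C * r ^ s)

/-- A process `(ξ n)` is *stationary* if for every `k` the joint law of `(ξ (n+k))_n`
coincides with the joint law of `(ξ n)_n`. -/
def IsStationaryProcess {Ω X : Type*} [MeasurableSpace Ω] [MeasurableSpace X]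
    (P : Measure Ω) (ξ : ℕ → Ω → X) : Prop :=
  ∀ k : ℕ, Measure.map (fun ω (n : ℕ) => ξ (n + k) ω) P
    = Measure.map (fun ω (n : ℕ) => ξ n ω) P

/-- A process `(ξ n)` is *exponentially mixing* (with constants `c > 0`, `0 < γ < 1`) if for
every `n ≥ 1`, every ball `A = B(y,ρ)` and every event `D` in the σ-field generated by
`(ξ (n+i))_{i ≥ 1}` with `P D > 0`, one has `|P(ξ 1 ∈ A | D) - P(ξ 1 ∈ A)| ≤ c γ^n`. -/
def IsExpMixingProcess {Ω X : Type*} [MeasurableSpace Ω] [MetricSpace X] [MeasurableSpace X]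
    (P : Measure Ω) (ξ : ℕ → Ω → X) (c γ : ℝ) : Prop :=
  ∀ n : ℕ, 1 ≤ n → ∀ (y : X) (ρ : ℝ) (D : Set Ω),
    MeasurableSet[⨆ i : ℕ, MeasurableSpace.comap (ξ (n + 1 + i)) inferInstance] D →
    0 < P D →
    |(P ({ω | ξ 1 ω ∈ ball y ρ} ∩ D)).toReal / (P D).toReal
      - (P {ω | ξ 1 ω ∈ ball y ρ}).toReal| ≤ c * γ ^ n

/-- Abstract second-moment Borel-Cantelli lemma. -/
theorem second_moment_bc {Ω : Type*} [MeasurableSpace Ω] (P : Measure Ω) [IsProbabilityMeasure P]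
    (E : ℕ → Set Ω) (hE : ∀ n, MeasurableSet (E n)) (c γ : ℝ) (hc : 0 < c) (hγ0 : 0 < γ)
    (hγ1 : γ < 1)
    (hmix : ∀ m k, m < k → P.real (E m ∩ E k)
      ≤ P.real (E m) * P.real (E k) + c * γ ^ (k - m) * P.real (E k))
    (hdiv : ¬ Summable (fun n => P.real (E n))) :
    P (Filter.limsup E atTop) = 1 := by
  set p : ℕ → ℝ := fun n => P.real (E n) with hp
  have hp0 : ∀ n, 0 ≤ p n := fun n => measureReal_nonneg
  set g : ℕ → Ω → ℝ := fun n => (E n).indicator (fun _ => (1 : ℝ)) with hg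
  have hgi : ∀ n, Integrable (g n) P := fun n => (integrable_const (1 : ℝ)).indicator (hE n)
  have hgint : ∀ n, ∫ ω, g n ω ∂P = p n := fun n => by
    simp [hg, hp, integral_indicator (hE n)]
  have hgg : ∀ m k, (fun ω => g m ω * g k ω) = (E m ∩ E k).indicator (fun _ => (1 : ℝ)) := by
    intro m k
    ext ω
    by_cases h1 : ω ∈ E m <;> by_cases h2 : ω ∈ E k <;> simp [hg, h1, h2]
  have hggi : ∀ m k, Integrable (fun ω => g m ω * g k ω) P := fun m k => by
    rw [hgg]; exact (integrable_const (1 : ℝ)).indicator ((hE m).inter (hE k))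
  have hggint : ∀ m k, ∫ ω, g m ω * g k ω ∂P = P.real (E m ∩ E k) := fun m k => by
    rw [hgg, integral_indicator ((hE m).inter (hE k))]; simp
  have hff : ∀ m k, (fun ω => (g m ω - p m) * (g k ω - p k))
      = fun ω => g m ω * g k ω - p k * g m ω - p m * g k ω + p m * p k := by
    intro m k; ext ω; ring
  have hffi : ∀ m k, Integrable (fun ω => (g m ω - p m) * (g k ω - p k)) P := fun m k => by
    rw [hff]
    exact (((hggi m k).sub ((hgi m).const_mul _)).sub ((hgi k).const_mul _)).add
      (integrable_const _)
  have hffint : ∀ m k, ∫ ω, (g m ω - p m) * (g k ω - p k) ∂P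
      = P.real (E m ∩ E k) - p m * p k := fun m k => by
    have j1 : Integrable (fun ω => p k * g m ω) P := (hgi m).const_mul _
    have j2 : Integrable (fun ω => p m * g k ω) P := (hgi k).const_mul _
    have j3 : Integrable (fun ω => g m ω * g k ω - p k * g m ω) P := (hggi m k).sub j1
    have j4 : Integrable (fun ω => g m ω * g k ω - p k * g m ω - p m * g k ω) P := j3.sub j2
    rw [hff, integral_add j4 (integrable_const _), integral_sub j3 j2, integral_sub (hggi m k) j1,
      integral_const_mul, integral_const_mul, hggint, hgint, hgint]
    simp
    ring
  set T : ℕ → Ω → ℝ := fun N ω => ∑ n ∈ Finset.range N, (g n ω - p n) with hT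
  set K : ℝ := 2 * (c * (1 - γ)⁻¹) + 1 with hK
  have hT2 : ∀ N, (fun ω => T (N+1) ω ^ 2) = fun ω => T N ω ^ 2
      + (2 * ∑ m ∈ Finset.range N, (g m ω - p m) * (g N ω - p N)
      + (g N ω - p N) * (g N ω - p N)) := by
    intro N; ext ω
    simp only [hT, Finset.sum_range_succ, ← Finset.sum_mul]
    ring
  have key : ∀ N, Integrable (fun ω => T N ω ^ 2) P ∧
      ∫ ω, T N ω ^ 2 ∂P ≤ K * ∑ n ∈ Finset.range N, p n := by
    intro N
    induction N with
    | zero => simp [hT]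
    | succ N ih =>
      obtain ⟨ih1, ih2⟩ := ih
      have i1 : Integrable (fun ω => ∑ m ∈ Finset.range N, (g m ω - p m) * (g N ω - p N)) P :=
        integrable_finsetSum _ (fun m _ => hffi m N)
      have i2 : Integrable (fun ω => 2 * ∑ m ∈ Finset.range N, (g m ω - p m) * (g N ω - p N)) P :=
        i1.const_mul 2
      have i3 : Integrable (fun ω => 2 * ∑ m ∈ Finset.range N, (g m ω - p m) * (g N ω - p N)
          + (g N ω - p N) * (g N ω - p N)) P := i2.add (hffi N N)
      rw [hT2 N]
      refine ⟨ih1.add i3, ?_⟩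
      have e1 : ∫ ω, (T N ω ^ 2
          + (2 * ∑ m ∈ Finset.range N, (g m ω - p m) * (g N ω - p N)
          + (g N ω - p N) * (g N ω - p N))) ∂P = ∫ ω, T N ω ^ 2 ∂P
          + (2 * ∑ m ∈ Finset.range N, (P.real (E m ∩ E N) - p m * p N)
          + (P.real (E N ∩ E N) - p N * p N)) := by
        rw [integral_add ih1 i3]
        congr 1
        refine (integral_add i2 (hffi N N)).trans ?_
        rw [integral_const_mul, integral_finsetSum _ (fun m _ => hffi m N), hffint]
        simp only [hffint]
      rw [e1, Finset.sum_range_succ, Set.inter_self]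
      have e2 : ∑ m ∈ Finset.range N, (P.real (E m ∩ E N) - p m * p N)
          ≤ c * (1 - γ)⁻¹ * p N := by
        calc ∑ m ∈ Finset.range N, (P.real (E m ∩ E N) - p m * p N)
            ≤ ∑ m ∈ Finset.range N, c * p N * γ ^ (N - m) := by
              refine Finset.sum_le_sum fun m hm => ?_
              have := hmix m N (Finset.mem_range.1 hm)
              simp only [hp]
              linarith
          _ = c * p N * ∑ m ∈ Finset.range N, γ ^ (m + 1) := by
              rw [Finset.mul_sum, ← Finset.sum_range_reflect]
              refine Finset.sum_congr rfl fun m hm => ?_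
              have := Finset.mem_range.1 hm
              congr 2
              omega
          _ ≤ c * p N * (1 - γ)⁻¹ := by
              refine mul_le_mul_of_nonneg_left ?_ (mul_nonneg hc.le (hp0 N))
              rw [← tsum_geometric_of_lt_one hγ0.le hγ1]
              refine le_trans (Finset.sum_le_sum fun m _ => ?_)
                ((summable_geometric_of_lt_one hγ0.le hγ1).sum_le_tsum (Finset.range N)
                  (fun i _ => pow_nonneg hγ0.le i))
              exact pow_le_pow_of_le_one hγ0.le hγ1.le (Nat.le_succ m)
          _ = _ := by ring
      have e3 : P.real (E N) = p N := rfl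
      rw [e3]
      have := mul_self_nonneg (p N)
      rw [hK] at *
      linarith
  have hM : Tendsto (fun N => ∑ n ∈ Finset.range N, p n) atTop atTop :=
    (not_summable_iff_tendsto_nat_atTop_of_nonneg hp0).1 hdiv
  have hK0 : 0 < K := by
    have : 0 < (1 - γ)⁻¹ := inv_pos.2 (by linarith)
    positivity
  -- the event that at most `L` of the sums occur is null
  have hnull : ∀ L : ℕ, P {ω | ∀ N, ∑ n ∈ Finset.range N, g n ω ≤ L} = 0 := by
    intro L
    set F := {ω | ∀ N, ∑ n ∈ Finset.range N, g n ω ≤ L} with hF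
    have hb : ∀ᶠ N in atTop, P.real F ≤ 4 * K * (∑ n ∈ Finset.range N, p n)⁻¹ := by
      filter_upwards [hM.eventually_ge_atTop (2 * L + 1 : ℝ)] with N hN
      set M := ∑ n ∈ Finset.range N, p n with hMd
      have hL : (0 : ℝ) ≤ L := Nat.cast_nonneg L
      have hM0 : 0 < M := by linarith
      have hsub : F ⊆ {ω | (M / 2) ^ 2 ≤ T N ω ^ 2} := by
        intro ω hω
        have h1 := hω N
        have h2 : T N ω = ∑ n ∈ Finset.range N, g n ω - M := by
          simp [hT, hMd, Finset.sum_sub_distrib]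
        show (M / 2) ^ 2 ≤ T N ω ^ 2
        rw [h2]
        nlinarith
      have hmk := mul_meas_ge_le_integral_of_nonneg
        (Eventually.of_forall fun ω => sq_nonneg (T N ω)) (key N).1 ((M / 2) ^ 2)
      have h3 : P.real F ≤ P.real {ω | (M / 2) ^ 2 ≤ T N ω ^ 2} := measureReal_mono hsub
      have h4 : (M / 2) ^ 2 * P.real F ≤ K * M :=
        (mul_le_mul_of_nonneg_left h3 (sq_nonneg _)).trans (hmk.trans (key N).2)
      rw [← div_eq_mul_inv, le_div_iff₀ hM0]
      have : M * (P.real F * M) ≤ M * (4 * K) := by nlinarith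
      exact le_of_mul_le_mul_left this hM0
    have hl : Tendsto (fun N => 4 * K * (∑ n ∈ Finset.range N, p n)⁻¹) atTop (nhds 0) := by
      simpa using (tendsto_inv_atTop_zero.comp hM).const_mul (4 * K)
    have h0 : P.real F ≤ 0 := ge_of_tendsto hl hb
    exact (measureReal_eq_zero_iff).1 (le_antisymm h0 measureReal_nonneg)
  have hml : MeasurableSet (limsup E atTop) := MeasurableSet.measurableSet_limsup hE
  rw [prob_compl_eq_zero_iff hml |>.symm]
  refine measure_mono_null (t := ⋃ L : ℕ, {ω | ∀ N, ∑ n ∈ Finset.range N, g n ω ≤ L}) ?_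
    (measure_iUnion_null hnull)
  intro ω hω
  have hω' : ¬ ∃ᶠ n in atTop, ω ∈ E n := by
    rw [← mem_limsup_iff_frequently_mem]; exact hω
  rw [not_frequently, eventually_atTop] at hω'
  obtain ⟨L, hL⟩ := hω'
  refine Set.mem_iUnion.2 ⟨L, fun N => ?_⟩
  have h1 : ∀ n, g n ω ≤ if n < L then 1 else 0 := by
    intro n
    by_cases hn : n < L
    · simp only [hg, hn, if_true]
      exact Set.indicator_le_self' (fun _ _ => zero_le_one) ω |>.trans le_rfl
    · have := hL n (not_lt.1 hn)
      simp [hg, hn, this]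
  calc ∑ n ∈ Finset.range N, g n ω ≤ ∑ n ∈ Finset.range N, (if n < L then (1 : ℝ) else 0) :=
        Finset.sum_le_sum fun n _ => h1 n
    _ ≤ L := by
        rw [← Finset.sum_filter, Finset.sum_const, nsmul_eq_mul, mul_one]
        have : (Finset.range N).filter (· < L) ⊆ Finset.range L := by
          intro n hn; simp at hn ⊢; exact hn.2
        exact_mod_cast (Finset.card_le_card this).trans (by simp)

/-- Lemma 2.1. If `(ξ n)` is an exponentially mixing stationary process with
values in a compact metric space whose common distribution `μ` is Ahlfors `s`-regular, and
`(h n)` is a sequence of positive reals decreasing to `0` with `∑ h n ^ s = ∞`, then for every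
`y` we have `P(ξ n ∈ B(y, h n) i.o.) = 1`. -/
theorem random_covering_borel_cantelli
    {Ω X : Type*} [MeasurableSpace Ω] [MetricSpace X] [CompactSpace X]
    [MeasurableSpace X] [BorelSpace X]
    (P : Measure Ω) [IsProbabilityMeasure P]
    (ξ : ℕ → Ω → X) (hmeas : ∀ n, Measurable (ξ n))
    (μ : Measure X) [IsProbabilityMeasure μ] (hdist : Measure.map (ξ 1) P = μ)
    (s : ℝ) (hs : 0 < s) (hreg : IsAhlforsRegular μ s)
    (hstat : IsStationaryProcess P ξ)
    (c γ : ℝ) (hc : 0 < c) (hγ0 : 0 < γ) (hγ1 : γ < 1)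
    (hmix : IsExpMixingProcess P ξ c γ)
    (h : ℕ → ℝ) (hpos : ∀ n, 0 < h n) (hanti : Antitone h)
    (hlim : Tendsto h atTop (nhds 0))
    (hdiv : ¬ Summable (fun n => h n ^ s))
    (y : X) :
    P (Filter.limsup (fun n => {ω | ξ n ω ∈ ball y (h n)}) atTop) = 1 := by
  have hEm : ∀ n, MeasurableSet {ω | ξ n ω ∈ ball y (h n)} :=
    fun n => hmeas n measurableSet_ball
  have hjoint : ∀ k a b (A B : Set X), MeasurableSet A → MeasurableSet B →
      P (ξ (a + k) ⁻¹' A ∩ ξ (b + k) ⁻¹' B) = P (ξ a ⁻¹' A ∩ ξ b ⁻¹' B) := by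
    intro k a b A B hA hB
    have hS : MeasurableSet {x : ℕ → X | x a ∈ A ∧ x b ∈ B} :=
      (measurable_pi_apply a hA).inter (measurable_pi_apply b hB)
    have := congrArg (fun ν => ν {x : ℕ → X | x a ∈ A ∧ x b ∈ B}) (hstat k)
    rw [Measure.map_apply (measurable_pi_lambda _ fun n => hmeas _) hS,
      Measure.map_apply (measurable_pi_lambda _ fun n => hmeas _) hS] at this
    exact this
  have hone : ∀ n (A : Set X), MeasurableSet A → P (ξ n ⁻¹' A) = μ A := by
    intro n A hA
    have h1 := hjoint n 0 0 A A hA hA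
    have h2 := hjoint 1 0 0 A A hA hA
    simp only [Set.inter_self, zero_add] at h1 h2
    rw [h1, ← h2, ← hdist, Measure.map_apply (hmeas 1) hA]
  by_cases hX : diam (Set.univ : Set X) = 0
  · have : ∀ x : X, x = y := fun x => by
      have hd := dist_le_diam_of_mem (isCompact_univ (X := X)).isBounded
        (Set.mem_univ x) (Set.mem_univ y)
      rw [hX] at hd
      exact dist_le_zero.1 hd
    have h1 : ∀ n, {ω | ξ n ω ∈ ball y (h n)} = Set.univ := fun n => by
      ext ω
      simp [this (ξ n ω), hpos n]
    simp only [h1]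
    simp
  have hX0 : 0 < diam (Set.univ : Set X) := lt_of_le_of_ne diam_nonneg (Ne.symm hX)
  refine second_moment_bc P _ hEm c γ hc hγ0 hγ1 ?_ ?_
  · intro m k hmk
    obtain ⟨n, rfl⟩ : ∃ n, k = n + m := ⟨k - m, by omega⟩
    have hn : 1 ≤ n := by omega
    set A := ball y (h m)
    set B := ball y (h (n + m))
    have hA : MeasurableSet A := measurableSet_ball
    have hB : MeasurableSet B := measurableSet_ball
    have h1 : P (ξ m ⁻¹' A ∩ ξ (n + m) ⁻¹' B) = P (ξ 1 ⁻¹' A ∩ ξ (n + 1) ⁻¹' B) := by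
      have e1 := hjoint m 0 n A B hA hB
      have e2 := hjoint 1 0 n A B hA hB
      simp only [zero_add] at e1 e2
      rw [e1, e2]
    change P.real (ξ m ⁻¹' A ∩ ξ (n + m) ⁻¹' B) ≤ P.real (ξ m ⁻¹' A) * P.real (ξ (n + m) ⁻¹' B)
      + c * γ ^ (n + m - m) * P.real (ξ (n + m) ⁻¹' B)
    simp only [measureReal_def]
    rw [h1, hone m A hA, hone (n + m) B hB, Nat.add_sub_cancel, ← hone 1 A hA,
      ← hone (n + 1) B hB]
    by_cases h0 : P (ξ (n + 1) ⁻¹' B) = 0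
    · rw [h0, measure_mono_null Set.inter_subset_right h0]; simp
    · have h2 := hmix n hn y (h m) (ξ (n + 1) ⁻¹' B)
        (le_iSup (fun i : ℕ => MeasurableSpace.comap (ξ (n + 1 + i)) inferInstance) 0 _
          ⟨B, hB, rfl⟩) (pos_iff_ne_zero.2 h0)
      · have h3 : 0 < (P (ξ (n + 1) ⁻¹' B)).toReal :=
          ENNReal.toReal_pos h0 (measure_ne_top _ _)
        have h4 := (abs_le.1 h2).2
        rw [sub_le_iff_le_add, div_le_iff₀ h3] at h4
        change (P (ξ 1 ⁻¹' A ∩ ξ (n + 1) ⁻¹' B)).toReal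
          ≤ (c * γ ^ n + (P (ξ 1 ⁻¹' A)).toReal) * _ at h4
        linarith
  · intro hsum
    apply hdiv
    obtain ⟨C, hC, hCr⟩ := hreg
    have hsum' := hsum.mul_left C
    refine Summable.of_norm_bounded_eventually_nat hsum' ?_
    filter_upwards [hlim.eventually_le_const hX0] with n hn
    have h1 := (hCr y (h n) (hpos n) hn).1
    have h2 : P {ω | ξ n ω ∈ ball y (h n)} = μ (ball y (h n)) := hone n _ measurableSet_ball
    have h3 : 0 ≤ h n ^ s := Real.rpow_nonneg (hpos n).le s
    rw [Real.norm_of_nonneg h3, measureReal_def, h2]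
    have h4 := (ENNReal.ofReal_le_iff_le_toReal (measure_ne_top _ _)).1 h1
    rwa [inv_mul_le_iff₀ hC] at h4
end

section
/- Let (ξ_n)_{n≥1} be an exponentially mixing stationary process with values in a compact metric space X whose common distribution μ is Ahlfors s-regular, and let (r_n)_{n≥1} be a sequence of positive reals decreasing to 0 with ∑_{n=1}^∞ r_n^s = ∞. Then almost surely the random covering set E = limsup_{n→∞} B(ξ_n, r_n) has full measure: μ(E) = 1. -/
open MeasureTheory Metric Filter

/-- A quasi-independence version of the divergence Borel-Cantelli lemma. -/
theorem bc_quasi {Ω : Type*} [MeasurableSpace Ω] (P : Measure Ω) [IsProbabilityMeasure P]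
    (A : ℕ → Set Ω) (hA : ∀ n, MeasurableSet (A n)) (K : ℝ) (hK : 0 ≤ K)
    (hq : ∀ N, ∑ n ∈ Finset.range N, P.real (A n ∩ A N)
      ≤ (∑ n ∈ Finset.range N, P.real (A n)) * P.real (A N) + K * P.real (A N))
    (hdiv : ¬ Summable (fun n => P.real (A n))) :
    ∀ᵐ ω ∂P, ∃ᶠ n in atTop, ω ∈ A n := by
  set e : ℕ → ℝ := fun N => ∑ n ∈ Finset.range N, P.real (A n) with he
  set S : ℕ → Ω → ℝ := fun N ω => ∑ n ∈ Finset.range N, (A n).indicator 1 ω with hS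
  have hind : ∀ n, Integrable ((A n).indicator (1 : Ω → ℝ)) P := fun n =>
    (integrable_const (1 : ℝ)).indicator (hA n)
  have hSi : ∀ N, Integrable (S N) P := fun N => integrable_finsetSum _ (fun n _ => hind n)
  have hSe : ∀ N, ∫ ω, S N ω ∂P = e N := by
    intro N
    simp only [hS, he]
    rw [integral_finsetSum _ (fun n _ => hind n)]
    exact Finset.sum_congr rfl (fun n _ => integral_indicator_one (hA n))
  have hprod : ∀ n m, (fun ω => (A n).indicator (1 : Ω → ℝ) ω * (A m).indicator 1 ω)
      = (A n ∩ A m).indicator 1 := by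
    intro n m; ext ω
    rw [Set.inter_indicator_one]; rfl
  have hSA : ∀ N, (fun ω => S N ω * (A N).indicator 1 ω)
      = fun ω => ∑ n ∈ Finset.range N, (A n ∩ A N).indicator (1 : Ω → ℝ) ω := by
    intro N; ext ω
    simp only [hS, Finset.sum_mul]
    exact Finset.sum_congr rfl (fun n _ => congrFun (hprod n N) ω)
  have hind2 : ∀ n m, Integrable ((A n ∩ A m).indicator (1 : Ω → ℝ)) P := fun n m =>
    (integrable_const (1 : ℝ)).indicator ((hA n).inter (hA m))
  have hSAi : ∀ N, Integrable (fun ω => S N ω * (A N).indicator 1 ω) P := by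
    intro N; rw [hSA]; exact integrable_finsetSum _ (fun n _ => hind2 n N)
  have hSAe : ∀ N, ∫ ω, S N ω * (A N).indicator 1 ω ∂P
      = ∑ n ∈ Finset.range N, P.real (A n ∩ A N) := by
    intro N; rw [hSA, integral_finsetSum _ (fun n _ => hind2 n N)]
    exact Finset.sum_congr rfl (fun n _ => integral_indicator_one ((hA n).inter (hA N)))
  have hstep : ∀ N, (fun ω => S (N+1) ω ^ 2) =
      fun ω => (S N ω ^ 2 + 2 * (S N ω * (A N).indicator 1 ω)) + (A N).indicator 1 ω := by
    intro N; ext ω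
    have h1 : (A N).indicator (1 : Ω → ℝ) ω * (A N).indicator 1 ω = (A N).indicator 1 ω := by
      have := congrFun (hprod N N) ω
      simpa using this
    simp only [hS, Finset.sum_range_succ]
    linear_combination h1
  have hQ : ∀ N, Integrable (fun ω => S N ω ^ 2) P ∧
      ∫ ω, S N ω ^ 2 ∂P ≤ e N ^ 2 + (2 * K + 1) * e N := by
    intro N
    induction N with
    | zero => simp [hS, he]
    | succ N ih =>
      obtain ⟨ih1, ih2⟩ := ih
      have i2 := (hSAi N).const_mul 2
      have i3 : Integrable (fun ω => S N ω ^ 2 + 2 * (S N ω * (A N).indicator 1 ω)) P :=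
        ih1.add i2
      rw [hstep]
      refine ⟨i3.add (hind N), ?_⟩
      have : ∫ ω, (S N ω ^ 2 + 2 * (S N ω * (A N).indicator 1 ω)) + (A N).indicator 1 ω ∂P
          = ∫ ω, S N ω ^ 2 ∂P + 2 * ∫ ω, S N ω * (A N).indicator 1 ω ∂P + P.real (A N) := by
        rw [integral_add i3 (hind N), integral_add ih1 i2, integral_const_mul,
          integral_indicator_one (hA N)]
      rw [this, hSAe]
      have h1 := hq N
      have h2 : e (N+1) = e N + P.real (A N) := by simp [he, Finset.sum_range_succ]
      rw [h2]
      change _ ≤ e N * _ + _ at h1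
      nlinarith [sq_nonneg (P.real (A N))]
  have hetop : Tendsto e atTop atTop :=
    (not_summable_iff_tendsto_nat_atTop_of_nonneg (fun n => measureReal_nonneg)).1 hdiv
  have hB : ∀ M : ℕ, P {ω | ∀ N, S N ω ≤ M} = 0 := by
    intro M
    set B := {ω | ∀ N, S N ω ≤ M} with hBdef
    have hSm : ∀ N, Measurable (S N) := fun N =>
      Finset.measurable_fun_sum _ (fun n _ => measurable_one.indicator (hA n))
    have hBm : MeasurableSet B := by
      rw [hBdef, Set.ofPred_forall]
      exact MeasurableSet.iInter fun N => measurableSet_le (hSm N) measurable_const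
    have key : ∀ N, (M : ℝ) ≤ e N → P.real B * (e N - M) ^ 2 ≤ (2 * K + 1) * e N := by
      intro N hN
      have i3 : Integrable (fun ω => S N ω ^ 2 - 2 * e N * S N ω) P :=
        (hQ N).1.sub ((hSi N).const_mul _)
      have iv : Integrable (fun ω => (S N ω ^ 2 - 2 * e N * S N ω) + e N ^ 2) P :=
        i3.add (integrable_const _)
      have hv : ∫ ω, (S N ω ^ 2 - 2 * e N * S N ω) + e N ^ 2 ∂P ≤ (2 * K + 1) * e N := by
        rw [integral_add i3 (integrable_const _),
          integral_sub (hQ N).1 ((hSi N).const_mul _), integral_const_mul, hSe]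
        have := (hQ N).2
        simp
        nlinarith
      refine le_trans ?_ hv
      have : P.real B * (e N - M) ^ 2 = ∫ ω, B.indicator (fun _ => (e N - M) ^ 2) ω ∂P := by
        rw [integral_indicator_const _ hBm, smul_eq_mul]
      rw [this]
      refine integral_mono ((integrable_const _).indicator hBm) iv ?_
      intro ω
      by_cases hω : ω ∈ B
      · simp only [Set.indicator_of_mem hω]
        have := hω N
        nlinarith
      · simp only [Set.indicator_of_notMem hω]
        nlinarith [sq_nonneg (S N ω - e N)]
    by_contra hne
    have hb : 0 < P.real B := by
      rw [measureReal_def]; exact ENNReal.toReal_pos hne (measure_ne_top _ _)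
    set b := P.real B with hbdef
    have h1 := hetop.eventually_ge_atTop ((M : ℝ))
    have h2 := hetop.eventually_gt_atTop (2 * M + (2 * K + 1) / b)
    obtain ⟨N, h1, h2⟩ := (h1.and h2).exists
    have h3 := key N h1
    have hM : (0 : ℝ) ≤ M := Nat.cast_nonneg M
    have hkb : 0 < (2 * K + 1) / b := by positivity
    have hepos : 0 < e N := by linarith
    have h4 : b * (2 * M + (2 * K + 1) / b) < b * e N := mul_lt_mul_of_pos_left h2 hb
    have h5 : b * (2 * M + (2 * K + 1) / b) = 2 * b * M + (2 * K + 1) := by field_simp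
    rw [h5] at h4
    have h6 := mul_lt_mul_of_pos_right h4 hepos
    nlinarith [mul_nonneg hb.le (sq_nonneg (M : ℝ))]
  have hall : ∀ᵐ ω ∂P, ∀ M : ℕ, ¬ (∀ N, S N ω ≤ M) := by
    rw [ae_all_iff]; intro M
    rw [ae_iff]; simpa using hB M
  filter_upwards [hall] with ω hω
  by_contra hcon
  rw [not_frequently, eventually_atTop] at hcon
  obtain ⟨M, hM⟩ := hcon
  refine hω M (fun N => ?_)
  have hle : ∀ n, (A n).indicator (1 : Ω → ℝ) ω ≤ if n < M then 1 else 0 := by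
    intro n
    by_cases hn : n < M
    · simp only [hn, if_true]
      exact Set.indicator_le_self' (fun _ _ => zero_le_one) ω
    · simp [hn, Set.indicator_of_notMem (hM n (not_lt.1 hn))]
  calc S N ω ≤ ∑ n ∈ Finset.range N, (if n < M then (1 : ℝ) else 0) :=
        Finset.sum_le_sum fun n _ => hle n
    _ = (((Finset.range N).filter (· < M)).card : ℝ) := by simp
    _ ≤ M := by
        have : ((Finset.range N).filter (· < M)) ⊆ Finset.range M := by
          intro x; simp
        exact_mod_cast (Finset.card_le_card this).trans_eq (Finset.card_range M)

theorem geo_bound (γ : ℝ) (h0 : 0 < γ) (h1 : γ < 1) (N : ℕ) :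
    ∑ n ∈ Finset.range N, γ ^ (N - n) ≤ 1 / (1 - γ) := by
  have hp : 0 < 1 - γ := by linarith
  induction N with
  | zero => simp; linarith
  | succ N ih =>
    have : ∑ n ∈ Finset.range (N+1), γ ^ (N + 1 - n)
        = γ * (∑ n ∈ Finset.range N, γ ^ (N - n) + 1) := by
      rw [Finset.sum_range_succ, mul_add, Finset.mul_sum]
      congr 1
      · refine Finset.sum_congr rfl fun n hn => ?_
        rw [Nat.succ_sub (Finset.mem_range.1 hn).le, pow_succ']
      · simp
    rw [this]
    have h2 : 1 / (1 - γ) = γ * (1 / (1 - γ) + 1) + (1 - γ) := by field_simp; ring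
    nlinarith

/-- divergence half of Theorem 1. If `(ξ n)` is an exponentially mixing
stationary process whose common distribution `μ` is Ahlfors `s`-regular and `(r n)` decreases
to `0` with `∑ r n ^ s = ∞`, then almost surely the random covering set
`E = limsup B(ξ n, r n)` has full `μ`-measure. -/
theorem random_covering_full_measure_of_not_summable
    {Ω X : Type*} [MeasurableSpace Ω] [MetricSpace X] [CompactSpace X]
    [MeasurableSpace X] [BorelSpace X]
    (P : Measure Ω) [IsProbabilityMeasure P]
    (ξ : ℕ → Ω → X) (hmeas : ∀ n, Measurable (ξ n))
    (μ : Measure X) [IsProbabilityMeasure μ] (hdist : Measure.map (ξ 1) P = μ)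
    (s : ℝ) (hs : 0 < s) (hreg : IsAhlforsRegular μ s)
    (hstat : IsStationaryProcess P ξ)
    (c γ : ℝ) (hc : 0 < c) (hγ0 : 0 < γ) (hγ1 : γ < 1)
    (hmix : IsExpMixingProcess P ξ c γ)
    (r : ℕ → ℝ) (hpos : ∀ n, 0 < r n) (hanti : Antitone r)
    (hlim : Tendsto r atTop (nhds 0))
    (hdiv : ¬ Summable (fun n => r n ^ s)) :
    ∀ᵐ ω ∂P, μ (Filter.limsup (fun n => ball (ξ n ω) (r n)) atTop) = 1 := by
  obtain ⟨C, hC, hreg⟩ := hreg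
  have hmarg : ∀ n m (U V : Set X), MeasurableSet U → MeasurableSet V → n ≤ m →
      P {ω | ξ n ω ∈ U ∧ ξ m ω ∈ V} = P {ω | ξ 1 ω ∈ U ∧ ξ (m - n + 1) ω ∈ V} := by
    intro n m U V hU hV hnm
    have hW : MeasurableSet {f : ℕ → X | f 0 ∈ U ∧ f (m - n) ∈ V} :=
      ((measurable_pi_apply 0) hU).inter ((measurable_pi_apply (m - n)) hV)
    have hm : ∀ k, Measurable (fun ω (n : ℕ) => ξ (n + k) ω) := fun k =>
      measurable_pi_lambda _ fun n => hmeas _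
    have h1 := congrArg (fun ν => ν {f : ℕ → X | f 0 ∈ U ∧ f (m - n) ∈ V})
      ((hstat n).trans (hstat 1).symm)
    simp only [Measure.map_apply (hm _) hW, Set.preimage_ofPred_eq, zero_add,
      Nat.sub_add_cancel hnm] at h1
    exact h1
  have hone : ∀ n (U : Set X), MeasurableSet U → P {ω | ξ n ω ∈ U} = μ U := by
    intro n U hU
    have := hmarg n n U Set.univ hU MeasurableSet.univ le_rfl
    simp only [Set.mem_univ, and_true] at this
    rw [this, ← hdist, Measure.map_apply (hmeas 1) hU]; rfl
  have hpt : ∀ y : X, ∀ᵐ ω ∂P, ∃ᶠ n in atTop, y ∈ ball (ξ n ω) (r n) := by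
    intro y
    have hsets : ∀ n, MeasurableSet {ω | ξ n ω ∈ ball y (r n)} := fun n =>
      hmeas n measurableSet_ball
    have hpair : ∀ n m, n < m →
        P.real ({ω | ξ n ω ∈ ball y (r n)} ∩ {ω | ξ m ω ∈ ball y (r m)}) ≤
          P.real {ω | ξ n ω ∈ ball y (r n)} * P.real {ω | ξ m ω ∈ ball y (r m)}
          + c * γ ^ (m - n) * P.real {ω | ξ m ω ∈ ball y (r m)} := by
      intro n m hnm
      have e1 := hmarg n m _ _ (measurableSet_ball (x := y) (ε := r n))
        (measurableSet_ball (x := y) (ε := r m)) hnm.le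
      have e2 := hone n _ (measurableSet_ball (x := y) (ε := r n))
      have e2' := hone 1 _ (measurableSet_ball (x := y) (ε := r n))
      have e3 := hone m _ (measurableSet_ball (x := y) (ε := r m))
      have e4 := hone (m - n + 1) _ (measurableSet_ball (x := y) (ε := r m))
      set D := {ω | ξ (m - n + 1) ω ∈ ball y (r m)} with hD
      have i1 : P.real ({ω | ξ n ω ∈ ball y (r n)} ∩ {ω | ξ m ω ∈ ball y (r m)})
          = (P ({ω | ξ 1 ω ∈ ball y (r n)} ∩ D)).toReal := by
        rw [measureReal_def]; exact congrArg _ e1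
      have i2 : P.real {ω | ξ n ω ∈ ball y (r n)} = (P {ω | ξ 1 ω ∈ ball y (r n)}).toReal := by
        rw [measureReal_def, e2, e2']
      have i3 : P.real {ω | ξ m ω ∈ ball y (r m)} = (P D).toReal := by
        rw [measureReal_def, e3, e4]
      rw [i1, i2, i3]
      by_cases hz : P D = 0
      · have : P ({ω | ξ 1 ω ∈ ball y (r n)} ∩ D) = 0 :=
          measure_mono_null Set.inter_subset_right hz
        rw [this, hz]; simp
      have hDm : MeasurableSet[⨆ i : ℕ,
          MeasurableSpace.comap (ξ (m - n + 1 + i)) inferInstance] D := by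
        refine (le_iSup (fun i : ℕ =>
          MeasurableSpace.comap (ξ (m - n + 1 + i)) inferInstance) 0) D ?_
        exact ⟨ball y (r m), measurableSet_ball, rfl⟩
      have hx := (abs_le.1 (hmix (m - n) (by omega) y (r n) D hDm (pos_iff_ne_zero.2 hz))).2
      have hDpos : 0 < (P D).toReal := ENNReal.toReal_pos hz (measure_ne_top _ _)
      rw [sub_le_iff_le_add, div_le_iff₀ hDpos] at hx
      linarith
    have hbc := bc_quasi P (fun n => {ω | ξ n ω ∈ ball y (r n)}) hsets (c * (1 / (1 - γ)))
      (mul_nonneg hc.le (one_div_nonneg.2 (by linarith))) ?_ ?_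
    · filter_upwards [hbc] with ω hω
      exact hω.mono fun n hn => mem_ball_comm.1 hn
    · intro N
      calc _ ≤ ∑ n ∈ Finset.range N, (P.real {ω | ξ n ω ∈ ball y (r n)} *
              P.real {ω | ξ N ω ∈ ball y (r N)}
              + c * γ ^ (N - n) * P.real {ω | ξ N ω ∈ ball y (r N)}) :=
            Finset.sum_le_sum fun n hn => hpair n N (Finset.mem_range.1 hn)
        _ = (∑ n ∈ Finset.range N, P.real {ω | ξ n ω ∈ ball y (r n)}) *
              P.real {ω | ξ N ω ∈ ball y (r N)}
              + c * (∑ n ∈ Finset.range N, γ ^ (N - n)) *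
                P.real {ω | ξ N ω ∈ ball y (r N)} := by
            rw [Finset.sum_add_distrib, Finset.sum_mul, Finset.mul_sum, Finset.sum_mul]
        _ ≤ _ := by
            have := geo_bound γ hγ0 hγ1 N
            gcongr
    · intro hsum
      have hreal : ∀ n, P.real {ω | ξ n ω ∈ ball y (r n)} = μ.real (ball y (r n)) := fun n => by
        rw [measureReal_def, hone n _ measurableSet_ball, measureReal_def]
      simp only [hreal] at hsum
      rcases (diam_nonneg (s := (Set.univ : Set X))).eq_or_lt with hd | hd
      · have hball : ∀ n, ball y (r n) = Set.univ := by
          intro n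
          ext z
          simp only [mem_ball, Set.mem_univ, iff_true]
          have := dist_le_diam_of_mem (isCompact_univ (X := X)).isBounded
            (Set.mem_univ z) (Set.mem_univ y)
          linarith [hpos n]
        simp only [hball, probReal_univ] at hsum
        have := hsum.tendsto_atTop_zero
        exact one_ne_zero (tendsto_nhds_unique tendsto_const_nhds this)
      · apply hdiv
        refine Summable.of_norm_bounded_eventually_nat (hsum.mul_left C) ?_
        filter_upwards [hlim.eventually_le_const hd] with n hn
        have h1 := (hreg y (r n) (hpos n) hn).1
        have hp : 0 ≤ r n ^ s := Real.rpow_nonneg (hpos n).le s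
        rw [ENNReal.ofReal_le_iff_le_toReal (measure_ne_top _ _), inv_mul_le_iff₀ hC] at h1
        rw [Real.norm_of_nonneg hp]
        exact h1
  have hmset : MeasurableSet {p : X × Ω | ∃ᶠ n in atTop, p.1 ∈ ball (ξ n p.2) (r n)} := by
    have hn : ∀ n, MeasurableSet {p : X × Ω | p.1 ∈ ball (ξ n p.2) (r n)} := fun n =>
      measurableSet_lt (measurable_fst.dist ((hmeas n).comp measurable_snd)) measurable_const
    have := MeasurableSet.measurableSet_limsup hn
    convert this using 1
    ext p
    simp only [mem_limsup_iff_frequently_mem, Set.mem_ofPred_eq]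
  have hae : ∀ᵐ ω ∂P, ∀ᵐ y ∂μ, ∃ᶠ n in atTop, y ∈ ball (ξ n ω) (r n) :=
    (Measure.ae_ae_comm (μ := μ) (ν := P) hmset).1 (Eventually.of_forall hpt)
  filter_upwards [hae] with ω hω
  have hmem : limsup (fun n => ball (ξ n ω) (r n)) atTop ∈ ae μ := by
    filter_upwards [hω] with y hy
    exact mem_limsup_iff_frequently_mem.2 hy
  refine le_antisymm prob_le_one ?_
  have h2 := measure_mono_ae (μ := μ) (s := Set.univ)
    (t := limsup (fun n => ball (ξ n ω) (r n)) atTop)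
    (by filter_upwards [hmem] with y hy _ using hy)
  rwa [measure_univ] at h2
end

section
/- Let (ξ_n)_{n≥1} be an exponentially mixing stationary process with values in a compact metric space X whose common distribution μ is Ahlfors s-regular, and let (r_n)_{n≥1} be positive reals decreasing to 0. Then almost surely the random covering set E = limsup_{n→∞} B(ξ_n, r_n) is dense in X. -/
open MeasureTheory Metric Filter

/-- Balls have positive measure. -/
theorem ahlfors_ball_pos {X : Type*} [MetricSpace X] [CompactSpace X] [MeasurableSpace X]
    (μ : Measure X) [IsProbabilityMeasure μ] (s : ℝ) (hreg : IsAhlforsRegular μ s)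
    (y : X) (ρ : ℝ) (hρ : 0 < ρ) : 0 < μ (ball y ρ) := by
  obtain ⟨C, hC, h⟩ := hreg
  by_cases hd : ρ ≤ diam (Set.univ : Set X)
  · refine lt_of_lt_of_le ?_ (h y ρ hρ hd).1
    rw [ENNReal.ofReal_pos]
    positivity
  · have : ball y ρ = Set.univ := by
      ext x
      simp only [mem_ball, Set.mem_univ, iff_true]
      exact lt_of_le_of_lt
        (dist_le_diam_of_mem isCompact_univ.isBounded (Set.mem_univ x) (Set.mem_univ y))
        (not_le.mp hd)
    rw [this]
    simp

/-- Almost surely every tail of the process visits a given ball. -/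
theorem ae_visits {Ω X : Type*} [MeasurableSpace Ω] [MetricSpace X] [CompactSpace X]
    [MeasurableSpace X] [BorelSpace X]
    (P : Measure Ω) [IsProbabilityMeasure P]
    (ξ : ℕ → Ω → X) (hmeas : ∀ n, Measurable (ξ n))
    (hstat : IsStationaryProcess P ξ)
    (c γ : ℝ) (hγ0 : 0 < γ) (hγ1 : γ < 1)
    (hmix : IsExpMixingProcess P ξ c γ) (y : X) (ρ : ℝ)
    (hp : 0 < P {ω | ξ 1 ω ∈ ball y ρ}) (N : ℕ) :
    ∀ᵐ ω ∂P, ∃ n, ξ (n + N) ω ∈ ball y ρ := by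
  set D : ℕ → Set Ω := fun k => {ω | ∀ n, ξ (n + k) ω ∉ ball y ρ} with hD
  have hS : MeasurableSet {x : ℕ → X | ∀ n, x n ∉ ball y ρ} := by
    rw [Set.setOf_forall]
    exact MeasurableSet.iInter fun n => (measurable_pi_apply n isOpen_ball.measurableSet).compl
  have hDk : ∀ k, P (D k) = P (D 0) := by
    intro k
    have h := congrArg (fun m => m {x : ℕ → X | ∀ n, x n ∉ ball y ρ}) (hstat k)
    rw [Measure.map_apply (measurable_pi_lambda _ fun n => hmeas _) hS,
      Measure.map_apply (measurable_pi_lambda _ fun n => hmeas _) hS] at h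
    exact h
  have hDm : ∀ n, MeasurableSet[⨆ i : ℕ, MeasurableSpace.comap (ξ (n + 1 + i)) inferInstance]
      (D (n + 1)) := by
    intro n
    have : D (n + 1) = ⋂ i, (ξ (n + 1 + i) ⁻¹' (ball y ρ)ᶜ) := by
      ext ω
      simp only [hD, Set.mem_setOf_eq, Set.mem_iInter, Set.mem_preimage, Set.mem_compl_iff]
      simp only [add_comm]
    rw [this]
    refine MeasurableSet.iInter fun i => ?_
    exact le_iSup (fun i : ℕ => MeasurableSpace.comap (ξ (n + 1 + i)) inferInstance) i _
      ⟨_, isOpen_ball.measurableSet.compl, rfl⟩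
  have hDM : ∀ k, MeasurableSet (D k) := by
    intro k
    exact (measurable_pi_lambda (fun ω (n : ℕ) => ξ (n + k) ω) fun n => hmeas _) hS
  have hzero : P (D 0) = 0 := by
    by_contra hne
    have hq : 0 < P (D 0) := pos_iff_ne_zero.mpr hne
    have hpr : 0 < (P {ω | ξ 1 ω ∈ ball y ρ}).toReal :=
      ENNReal.toReal_pos hp.ne' (measure_ne_top _ _)
    have hlim : Tendsto (fun n : ℕ => c * γ ^ n) atTop (nhds (c * 0)) :=
      (tendsto_pow_atTop_nhds_zero_of_lt_one hγ0.le hγ1).const_mul c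
    rw [mul_zero] at hlim
    obtain ⟨n, hn, hn1⟩ := ((hlim.eventually_lt_const hpr).and (eventually_ge_atTop 1)).exists
    have h := hmix n hn1 y ρ (D (n + 1)) (hDm n) (by rw [hDk]; exact hq)
    have hsub : D 1 ⊆ D (n + 1) := by
      intro ω hω m
      have := hω (m + n)
      rwa [add_assoc] at this
    have hdiff : P (D (n + 1) \ D 1) = 0 := by
      rw [measure_sdiff hsub (hDM 1).nullMeasurableSet (measure_ne_top _ _), hDk, hDk 1,
        tsub_self]
    have hz : P ({ω | ξ 1 ω ∈ ball y ρ} ∩ D (n + 1)) = 0 := by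
      refine measure_mono_null ?_ hdiff
      rintro ω ⟨h1, h2⟩
      refine ⟨h2, fun h3 => h3 0 ?_⟩
      simpa using h1
    rw [hz, ENNReal.toReal_zero, zero_div, zero_sub, abs_neg, abs_of_pos hpr] at h
    linarith
  rw [ae_iff]
  have : {ω | ¬ ∃ n, ξ (n + N) ω ∈ ball y ρ} = D N := by
    ext ω
    simp [hD]
  rw [this, hDk, hzero]

/-- Theorem 3. If `(ξ n)` is an exponentially mixing stationary process
whose common distribution `μ` is Ahlfors `s`-regular and `(r n)` decreases to `0`, then
almost surely the random covering set `E = limsup B(ξ n, r n)` is dense in `X`. -/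
theorem random_covering_dense
    {Ω X : Type*} [MeasurableSpace Ω] [MetricSpace X] [CompactSpace X]
    [MeasurableSpace X] [BorelSpace X]
    (P : Measure Ω) [IsProbabilityMeasure P]
    (ξ : ℕ → Ω → X) (hmeas : ∀ n, Measurable (ξ n))
    (μ : Measure X) [IsProbabilityMeasure μ] (hdist : Measure.map (ξ 1) P = μ)
    (s : ℝ) (hs : 0 < s) (hreg : IsAhlforsRegular μ s)
    (hstat : IsStationaryProcess P ξ)
    (c γ : ℝ) (hc : 0 < c) (hγ0 : 0 < γ) (hγ1 : γ < 1)
    (hmix : IsExpMixingProcess P ξ c γ)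
    (r : ℕ → ℝ) (hpos : ∀ n, 0 < r n) (hanti : Antitone r)
    (hlim : Tendsto r atTop (nhds 0)) :
    ∀ᵐ ω ∂P, Dense (Filter.limsup (fun n => ball (ξ n ω) (r n)) atTop) := by
  have hvis : ∀ᵐ ω ∂P, ∀ (N m : ℕ), ∀ y ∈ TopologicalSpace.exists_countable_dense X |>.choose,
      ∃ n, ξ (n + N) ω ∈ ball y (1 / ((m : ℝ) + 1)) := by
    rw [ae_all_iff]; intro N
    rw [ae_all_iff]; intro m
    rw [ae_ball_iff (TopologicalSpace.exists_countable_dense X).choose_spec.1]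
    intro y _
    refine ae_visits P ξ hmeas hstat c γ hγ0 hγ1 hmix y _ ?_ N
    have := ahlfors_ball_pos μ s hreg y (1 / ((m : ℝ) + 1)) (by positivity)
    rw [← hdist, Measure.map_apply (hmeas 1) isOpen_ball.measurableSet] at this
    exact this
  have hT := (TopologicalSpace.exists_countable_dense X).choose_spec.2
  filter_upwards [hvis] with ω hω
  rw [Filter.limsup_eq_iInf_iSup_of_nat]
  simp only [Set.iInf_eq_iInter, Set.iSup_eq_iUnion]
  refine dense_iInter_of_isOpen (fun N => isOpen_biUnion fun n _ => isOpen_ball) ?_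
  intro N
  rw [Metric.dense_iff]
  intro x ε hε
  obtain ⟨m, hm⟩ := exists_nat_one_div_lt (half_pos hε)
  obtain ⟨y, hyT, hy⟩ := hT.exists_dist_lt x (half_pos hε)
  obtain ⟨n, hn⟩ := hω N m y hyT
  refine ⟨ξ (n + N) ω, ?_, ?_⟩
  · rw [mem_ball] at hn ⊢
    have := dist_triangle (ξ (n + N) ω) y x
    rw [dist_comm y x] at this
    linarith
  · simp only [Set.mem_iUnion]
    exact ⟨n + N, by omega, mem_ball_self (hpos _)⟩
end

section
/- Let (ξ_n)_{n≥1} be an exponentially mixing stationary process with values in a compact metric space X whose common distribution μ is Ahlfors s-regular, and let (r_n)_{n≥1} be positive reals decreasing to 0. Then for every fixed ball B = B(a, r) in X with r > 0, ℙ( limsup_{n→∞} B(ξ_n, r_n) ∩ B ≠ ∅ ) = 1. -/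
open MeasureTheory Metric Filter

lemma ball_visits
    {Ω X : Type*} [MeasurableSpace Ω] [MetricSpace X]
    [MeasurableSpace X] [BorelSpace X]
    (P : Measure Ω) [IsProbabilityMeasure P]
    (ξ : ℕ → Ω → X) (hmeas : ∀ n, Measurable (ξ n))
    (hstat : IsStationaryProcess P ξ)
    (c γ : ℝ) (hγ0 : 0 < γ) (hγ1 : γ < 1)
    (hmix : IsExpMixingProcess P ξ c γ) (y : X) (ρ : ℝ)
    (hA : P {ω | ξ 1 ω ∈ ball y ρ} ≠ 0) (N : ℕ) :
    ∀ᵐ ω ∂P, ∃ n, N ≤ n ∧ ξ n ω ∈ ball y ρ := by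
  let D : ℕ → Set Ω := fun N => {ω | ∀ n, ξ (n + N) ω ∉ ball y ρ}
  have hS : MeasurableSet {x : ℕ → X | ∀ n, x n ∉ ball y ρ} := by
    have : {x : ℕ → X | ∀ n, x n ∉ ball y ρ} = ⋂ n, (fun x : ℕ → X => x n) ⁻¹' (ball y ρ)ᶜ := by
      ext x; simp
    rw [this]
    exact MeasurableSet.iInter fun n => (measurable_pi_apply n) measurableSet_ball.compl
  have hDm : ∀ N, MeasurableSet (D N) := fun N =>
    (measurable_pi_lambda (fun ω (n : ℕ) => ξ (n + N) ω) fun n => hmeas (n + N)) hS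
  have hD : ∀ N, P (D N) = P (D 0) := by
    intro N
    have h := congrArg (fun m => m {x : ℕ → X | ∀ n, x n ∉ ball y ρ}) (hstat N)
    rw [Measure.map_apply (measurable_pi_lambda _ fun n => hmeas (n + N)) hS,
      Measure.map_apply (measurable_pi_lambda _ fun n => hmeas n) hS] at h
    exact h
  have hmono : ∀ N, 1 ≤ N → D 1 ⊆ D N := by
    intro N hN ω hω n
    have := hω (n + (N - 1))
    rwa [show n + (N - 1) + 1 = n + N by omega] at this
  have hzero : P (D 0) = 0 := by
    by_contra hne
    have key : ∀ n : ℕ, 1 ≤ n → (P {ω | ξ 1 ω ∈ ball y ρ}).toReal ≤ c * γ ^ n := by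
      intro n hn
      have hDmeas : MeasurableSet[⨆ i : ℕ, MeasurableSpace.comap (ξ (n + 1 + i)) inferInstance]
          (D (n + 1)) := by
        have : D (n + 1) = ⋂ i, (ξ (n + 1 + i)) ⁻¹' (ball y ρ)ᶜ := by
          ext ω
          simp only [D, Set.mem_setOf_eq, Set.mem_iInter, Set.mem_preimage, Set.mem_compl_iff]
          exact forall_congr' fun i => by rw [Nat.add_comm i]
        rw [this]
        refine MeasurableSet.iInter fun i => ?_
        refine (le_iSup (fun i : ℕ => MeasurableSpace.comap (ξ (n + 1 + i)) inferInstance) i) _ ?_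
        exact ⟨_, measurableSet_ball.compl, rfl⟩
      have h := hmix n hn y ρ (D (n + 1)) hDmeas (by rw [hD]; exact pos_iff_ne_zero.2 hne)
      have h0 : P ({ω | ξ 1 ω ∈ ball y ρ} ∩ D (n + 1)) = 0 := by
        have hdiff : P (D (n + 1) \ D 1) = 0 := by
          rw [measure_diff (hmono _ (by omega)) (hDm 1).nullMeasurableSet (measure_ne_top _ _),
            hD (n + 1), hD 1, tsub_self]
        refine measure_mono_null ?_ hdiff
        rintro ω ⟨h1, h2⟩
        refine ⟨h2, fun h3 => h3 0 ?_⟩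
        simpa using h1
      rw [h0] at h
      simpa using h
    have hl : Tendsto (fun n : ℕ => c * γ ^ n) atTop (nhds 0) := by
      simpa using (tendsto_pow_atTop_nhds_zero_of_lt_one hγ0.le hγ1).const_mul c
    have hle := ge_of_tendsto hl (eventually_atTop.2 ⟨1, key⟩)
    have := ENNReal.toReal_pos hA (measure_ne_top _ _)
    linarith
  have hN : P (D N) = 0 := by rw [hD, hzero]
  have := measure_eq_zero_iff_ae_notMem.1 hN
  filter_upwards [this] with ω hω
  simp only [D, Set.mem_setOf_eq, not_forall, not_not] at hω
  obtain ⟨n, hn⟩ := hω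
  exact ⟨n + N, by omega, hn⟩

/-- If `(ξ n)` is an exponentially mixing stationary process whose common
distribution `μ` is Ahlfors `s`-regular and `(r n)` decreases to `0`, then for every fixed
ball `B = B(a, ρ)` with `ρ > 0`, the random covering set meets `B` almost surely. -/
theorem random_covering_meets_ball
    {Ω X : Type*} [MeasurableSpace Ω] [MetricSpace X] [CompactSpace X]
    [MeasurableSpace X] [BorelSpace X]
    (P : Measure Ω) [IsProbabilityMeasure P]
    (ξ : ℕ → Ω → X) (hmeas : ∀ n, Measurable (ξ n))
    (μ : Measure X) [IsProbabilityMeasure μ] (hdist : Measure.map (ξ 1) P = μ)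
    (s : ℝ) (hs : 0 < s) (hreg : IsAhlforsRegular μ s)
    (hstat : IsStationaryProcess P ξ)
    (c γ : ℝ) (hc : 0 < c) (hγ0 : 0 < γ) (hγ1 : γ < 1)
    (hmix : IsExpMixingProcess P ξ c γ)
    (r : ℕ → ℝ) (hpos : ∀ n, 0 < r n) (hanti : Antitone r)
    (hlim : Tendsto r atTop (nhds 0))
    (a : X) (ρ : ℝ) (hρ : 0 < ρ) :
    P {ω | (Filter.limsup (fun n => ball (ξ n ω) (r n)) atTop ∩ ball a ρ).Nonempty} = 1 := by
  have hposball : ∀ (y : X) (δ : ℝ), 0 < δ → P {ω | ξ 1 ω ∈ ball y δ} ≠ 0 := by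
    intro y δ hδ
    have hP : P {ω | ξ 1 ω ∈ ball y δ} = μ (ball y δ) := by
      rw [← hdist, Measure.map_apply (hmeas 1) measurableSet_ball]; rfl
    rw [hP]
    rcases (diam_nonneg (s := (Set.univ : Set X))).eq_or_lt with h0 | h0
    · have : ball y δ = Set.univ := by
        refine Set.eq_univ_of_forall fun z => ?_
        have := dist_le_diam_of_mem (isCompact_univ (X := X)).isBounded
          (Set.mem_univ z) (Set.mem_univ y)
        exact mem_ball.2 (by linarith)
      rw [this]; simp
    · obtain ⟨C, hC, h⟩ := hreg
      have hm : 0 < min δ (diam (Set.univ : Set X)) := lt_min hδ h0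
      have h1 := (h y _ hm (min_le_right _ _)).1
      have h2 : 0 < ENNReal.ofReal (C⁻¹ * min δ (diam (Set.univ : Set X)) ^ s) :=
        ENNReal.ofReal_pos.2 (mul_pos (inv_pos.2 hC) (Real.rpow_pos_of_pos hm _))
      exact ((h2.trans_le h1).trans_le (measure_mono (ball_subset_ball (min_le_left _ _)))).ne'
  haveI : Nonempty X := ⟨a⟩
  have hae : ∀ᵐ ω ∂P, ∀ i k N : ℕ, ∃ n, N ≤ n ∧
      ξ n ω ∈ ball (TopologicalSpace.denseSeq X i) (1 / ((k : ℝ) + 1)) := by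
    simp only [ae_all_iff]
    intro i k N
    exact ball_visits P ξ hmeas hstat c γ hγ0 hγ1 hmix _ _
      (hposball _ _ (by positivity)) N
  have hfin : ∀ᵐ ω ∂P,
      (Filter.limsup (fun n => ball (ξ n ω) (r n)) atTop ∩ ball a ρ).Nonempty := by
    filter_upwards [hae] with ω hω
    let U : ℕ → Set X := fun N => ⋃ n, ⋃ (_ : N ≤ n), ball (ξ n ω) (r n)
    have hUo : ∀ N, IsOpen (U N) := fun N =>
      isOpen_iUnion fun n => isOpen_iUnion fun _ => isOpen_ball
    have hUd : ∀ N, Dense (U N) := by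
      intro N
      rw [Metric.dense_iff]
      intro x ε hε
      obtain ⟨k, hk⟩ := exists_nat_one_div_lt (half_pos hε)
      obtain ⟨i, hi⟩ := (TopologicalSpace.denseRange_denseSeq X).exists_dist_lt x (half_pos hε)
      obtain ⟨n, hn, hmem⟩ := hω i k N
      refine ⟨ξ n ω, ?_, ?_⟩
      · rw [mem_ball] at hmem ⊢
        have := dist_triangle (ξ n ω) (TopologicalSpace.denseSeq X i) x
        rw [dist_comm x] at hi
        linarith
      · simp only [U, Set.mem_iUnion]
        exact ⟨n, hn, mem_ball_self (hpos n)⟩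
    have hd : Dense (⋂ N, U N) := dense_iInter_of_isOpen hUo hUd
    obtain ⟨x, hx1, hx2⟩ := hd.inter_open_nonempty (ball a ρ) isOpen_ball ⟨a, mem_ball_self hρ⟩
    refine ⟨x, ?_, hx1⟩
    rw [Filter.mem_limsup_iff_frequently_mem, frequently_atTop]
    intro N
    have := Set.mem_iInter.1 hx2 N
    simp only [U, Set.mem_iUnion] at this
    obtain ⟨n, hn, h⟩ := this
    exact ⟨n, hn, h⟩
  rw [measure_eq_measure_of_null_sdiff (Set.subset_univ _) ?_]
  · simp
  · rw [← Set.compl_eq_univ_diff]; exact hfin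
end

section
/- Let (ξ_n)_{n≥1} be an exponentially mixing stationary process with values in a compact metric space X whose common distribution μ is Ahlfors s-regular, and let (r_n)_{n≥1} be positive reals decreasing to 0. Then almost surely the random covering set E = limsup_{n→∞} B(ξ_n, r_n) is residual in X, i.e. its complement X \ E is a set of first category (meager). -/
open MeasureTheory Metric Filter

theorem never_visit_null
    {Ω X : Type*} [MeasurableSpace Ω] [MetricSpace X]
    [MeasurableSpace X] [BorelSpace X]
    (P : Measure Ω) [IsProbabilityMeasure P]
    (ξ : ℕ → Ω → X) (hmeas : ∀ n, Measurable (ξ n))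
    (hstat : IsStationaryProcess P ξ)
    (c γ : ℝ) (hγ0 : 0 < γ) (hγ1 : γ < 1)
    (hmix : IsExpMixingProcess P ξ c γ) (y : X) (ρ : ℝ)
    (hp : 0 < P {ω | ξ 1 ω ∈ ball y ρ}) (m : ℕ) :
    P {ω | ∀ n, ξ (n + m) ω ∉ ball y ρ} = 0 := by
  have hset : MeasurableSet {f : ℕ → X | ∀ n, f n ∉ ball y ρ} := by
    have : {f : ℕ → X | ∀ n, f n ∉ ball y ρ} = ⋂ n, (fun f : ℕ → X => f n) ⁻¹' (ball y ρ)ᶜ := by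
      ext f; simp
    rw [this]
    exact MeasurableSet.iInter fun n => (measurable_pi_apply n) measurableSet_ball.compl
  have hG : ∀ k, P {ω | ∀ n, ξ (n + k) ω ∉ ball y ρ} = P {ω | ∀ n, ξ n ω ∉ ball y ρ} := by
    intro k
    have h := congrArg (fun ν => ν {f : ℕ → X | ∀ n, f n ∉ ball y ρ}) (hstat k)
    rw [Measure.map_apply (measurable_pi_lambda _ fun n => hmeas _) hset,
      Measure.map_apply (measurable_pi_lambda _ fun n => hmeas _) hset] at h
    exact h
  have hGm : ∀ k, MeasurableSet {ω | ∀ n, ξ (n + k) ω ∉ ball y ρ} := fun k =>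
    (measurable_pi_lambda (fun ω (n : ℕ) => ξ (n + k) ω) fun n => hmeas _) hset
  rw [hG m]
  by_contra hq
  have hG0 : MeasurableSet {ω | ∀ n, ξ n ω ∉ ball y ρ} := hGm 0
  have key : ∀ n : ℕ, 1 ≤ n → (P {ω | ξ 1 ω ∈ ball y ρ}).toReal ≤ c * γ ^ n := by
    intro n hn
    have hD : MeasurableSet[⨆ i : ℕ, MeasurableSpace.comap (ξ (n + 1 + i)) inferInstance]
        {ω | ∀ i, ξ (i + (n + 1)) ω ∉ ball y ρ} := by
      have : {ω | ∀ i, ξ (i + (n + 1)) ω ∉ ball y ρ}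
          = ⋂ i, (ξ (n + 1 + i)) ⁻¹' (ball y ρ)ᶜ := by
        ext f; simp [add_comm]
      rw [this]
      refine MeasurableSet.iInter fun i => ?_
      exact le_iSup (fun i : ℕ => MeasurableSpace.comap (ξ (n + 1 + i)) inferInstance) i _
        ⟨_, measurableSet_ball.compl, rfl⟩
    have h := hmix n hn y ρ _ hD (by rw [hG]; exact pos_iff_ne_zero.2 hq)
    have h0 : P ({ω | ξ 1 ω ∈ ball y ρ} ∩ {ω | ∀ i, ξ (i + (n + 1)) ω ∉ ball y ρ}) = 0 := by
      have hd : P ({ω | ∀ i, ξ (i + (n + 1)) ω ∉ ball y ρ} \ {ω | ∀ n, ξ n ω ∉ ball y ρ}) = 0 := by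
        have hsub : {ω | ∀ n, ξ n ω ∉ ball y ρ} ⊆ {ω | ∀ i, ξ (i + (n + 1)) ω ∉ ball y ρ} :=
          fun ω hω i => hω _
        rw [measure_sdiff hsub hG0.nullMeasurableSet (measure_ne_top _ _), hG,
          tsub_self]
      refine measure_mono_null ?_ hd
      rintro ω ⟨h1, h2⟩
      exact ⟨h2, fun h3 => h3 1 h1⟩
    rw [h0] at h
    simp only [ENNReal.toReal_zero, zero_div, zero_sub, abs_neg] at h
    exact (le_abs_self _).trans h
  have ht : Tendsto (fun n : ℕ => c * γ ^ n) atTop (nhds (c * 0)) :=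
    (tendsto_pow_atTop_nhds_zero_of_lt_one hγ0.le hγ1).const_mul c
  have hle := ge_of_tendsto ht (eventually_atTop.2 ⟨1, key⟩)
  have := ENNReal.toReal_pos hp.ne' (measure_ne_top _ _)
  linarith

/-- Theorem 4, residual part. If `(ξ n)` is an exponentially mixing
stationary process whose common distribution `μ` is Ahlfors `s`-regular and `(r n)` decreases
to `0`, then almost surely the random covering set `E = limsup B(ξ n, r n)` is residual,
i.e. its complement is meager (of first category). -/
theorem random_covering_residual
    {Ω X : Type*} [MeasurableSpace Ω] [MetricSpace X] [CompactSpace X]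
    [MeasurableSpace X] [BorelSpace X]
    (P : Measure Ω) [IsProbabilityMeasure P]
    (ξ : ℕ → Ω → X) (hmeas : ∀ n, Measurable (ξ n))
    (μ : Measure X) [IsProbabilityMeasure μ] (hdist : Measure.map (ξ 1) P = μ)
    (s : ℝ) (hs : 0 < s) (hreg : IsAhlforsRegular μ s)
    (hstat : IsStationaryProcess P ξ)
    (c γ : ℝ) (hc : 0 < c) (hγ0 : 0 < γ) (hγ1 : γ < 1)
    (hmix : IsExpMixingProcess P ξ c γ)
    (r : ℕ → ℝ) (hpos : ∀ n, 0 < r n) (hanti : Antitone r)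
    (hlim : Tendsto r atTop (nhds 0)) :
    ∀ᵐ ω ∂P, IsMeagre (Filter.limsup (fun n => ball (ξ n ω) (r n)) atTop)ᶜ := by
  have hX : Nonempty X := by
    by_contra h
    have := not_nonempty_iff.1 h
    have h1 := measure_univ (μ := μ)
    rw [Set.univ_eq_empty_iff.2 this, measure_empty] at h1
    exact zero_ne_one h1
  have hball : ∀ (y : X) (ρ : ℝ), 0 < ρ → 0 < μ (ball y ρ) := by
    intro y ρ hρ
    obtain ⟨C, hC, hreg⟩ := hreg
    rcases (diam_nonneg (s := (Set.univ : Set X))).eq_or_lt with hd | hd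
    · have : ball y ρ = Set.univ := by
        refine Set.eq_univ_of_forall fun x => ?_
        have := dist_le_diam_of_mem (isCompact_univ (X := X)).isBounded
          (Set.mem_univ x) (Set.mem_univ y)
        rw [mem_ball]; linarith
      rw [this, measure_univ]; exact one_pos
    · have hm : 0 < min ρ (diam (Set.univ : Set X)) := lt_min hρ hd
      refine lt_of_lt_of_le ?_ ((hreg y _ hm (min_le_right _ _)).1.trans
        (measure_mono (ball_subset_ball (min_le_left _ _))))
      rw [ENNReal.ofReal_pos]
      have := Real.rpow_pos_of_pos hm s
      positivity
  have hae : ∀ᵐ ω ∂P, ∀ k j m : ℕ, ∃ n,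
      ξ (n + m) ω ∈ ball (TopologicalSpace.denseSeq X k) (1 / ((j : ℝ) + 1)) := by
    rw [ae_all_iff]; intro k
    rw [ae_all_iff]; intro j
    rw [ae_all_iff]; intro m
    have h1 : 0 < P {ω | ξ 1 ω ∈ ball (TopologicalSpace.denseSeq X k) (1 / ((j : ℝ) + 1))} := by
      have h2 := hball (TopologicalSpace.denseSeq X k) (1 / ((j : ℝ) + 1)) (by positivity)
      rw [← hdist, Measure.map_apply (hmeas 1) measurableSet_ball] at h2
      exact h2
    have h := never_visit_null P ξ hmeas hstat c γ hγ0 hγ1 hmix _ _ h1 m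
    rw [ae_iff]
    simpa only [not_exists] using h
  filter_upwards [hae] with ω hω
  have hE : (⋂ m : ℕ, ⋃ n : ℕ, ball (ξ (n + m) ω) (r (n + m)))
      ⊆ Filter.limsup (fun n => ball (ξ n ω) (r n)) atTop := by
    intro x hx
    rw [Filter.limsup_eq_iInf_iSup_of_nat']
    simp only [Set.iInf_eq_iInter, Set.iSup_eq_iUnion]
    exact hx
  rw [IsMeagre, compl_compl]
  refine mem_of_superset ?_ hE
  rw [countable_iInter_mem]
  intro m
  refine residual_of_dense_open (isOpen_iUnion fun n => isOpen_ball) ?_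
  rw [Metric.dense_iff]
  intro x ε hε
  obtain ⟨j, hj⟩ := exists_nat_one_div_lt (half_pos hε)
  obtain ⟨z, hz, k, rfl⟩ := (Metric.dense_iff.1 (TopologicalSpace.denseRange_denseSeq X)) x
    (ε / 2) (half_pos hε)
  obtain ⟨n, hn⟩ := hω k j m
  refine ⟨ξ (n + m) ω, ?_, Set.mem_iUnion.2 ⟨n, mem_ball_self (hpos _)⟩⟩
  rw [mem_ball] at *
  have := dist_triangle (ξ (n + m) ω) (TopologicalSpace.denseSeq X k) x
  linarith
end

section
/- (Beresnevich–Velani mass transference principle.) Let (Y,ρ) be a locally compact metric space and g a doubling dimension function for which there exist constants 0 < c₁ < 1 < c₂ < ∞ and r₀ > 0 such that c₁ g(r) ≤ H^g(B(x,r)) ≤ c₂ g(r) for every x ∈ Y and 0 < r ≤ r₀. Let (B_i)_{i∈ℕ} be a sequence of balls B_i = B(x_i, r_i) in Y with r_i → 0, and let f be a dimension function such that f(r)/g(r) is monotonic. For a ball B = B(x,r) write B^f = B(x, g^{-1}(f(r))). If for every ball B in Y one has H^g(B ∩ limsup_{i→∞} B_i^f) = H^g(B), then for every ball B in Y one has H^f(B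 ∩ limsup_{i→∞} B_i) = H^f(B). -/
open MeasureTheory Metric Filter

/-- A *dimension function* `f : (0,∞) → (0,∞)` is continuous, non-decreasing and tends to `0`
at `0`. -/
def IsDimensionFunction (f : ℝ → ℝ) : Prop :=
  ContinuousOn f (Set.Ioi 0) ∧ MonotoneOn f (Set.Ioi 0) ∧ (∀ r > 0, 0 < f r) ∧
    Filter.Tendsto f (nhdsWithin 0 (Set.Ioi 0)) (nhds 0)

/-- A dimension function is *doubling* if `f (2r) ≤ η f r` for some `η > 1` and all `r > 0`. -/
def IsDoubling (f : ℝ → ℝ) : Prop :=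
  ∃ η : ℝ, 1 < η ∧ ∀ r > 0, f (2 * r) ≤ η * f r

/-- The Hausdorff measure `H^f` constructed from the gauge function `f`. -/
noncomputable def gaugeHausdorff {X : Type*} [MetricSpace X] [MeasurableSpace X] [BorelSpace X]
    (f : ℝ → ℝ) : Measure X :=
  Measure.mkMetric (fun d : ENNReal => ENNReal.ofReal (f d.toReal))

section mtpaux
open scoped ENNReal NNReal

structure MTPData {Y : Type*} [MetricSpace Y] [MeasurableSpace Y] (μ : Measure Y)
    (F G : ℝ → ℝ≥0∞) (C : ℝ≥0) (R : ℝ) (x : ℕ → Y) (r s : ℕ → ℝ) : Prop where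
  R_pos : 0 < R
  C_one : 1 ≤ C
  low : ∀ y t, 0 < t → t ≤ R → G t ≤ C * μ (ball y (t / 2))
  up : ∀ y t, 0 < t → t ≤ R → μ (closedBall y (8 * t)) ≤ C * G t
  Fmono : ∀ u v, 0 < u → u ≤ v → F u ≤ F v
  Gmono : ∀ u v, 0 < u → u ≤ v → G u ≤ G v
  Ffin : ∀ u, F u ≠ ⊤
  Gfin : ∀ u, G u ≠ ⊤
  Fpos : ∀ u, 0 < u → F u ≠ 0
  Gpos : ∀ u, 0 < u → G u ≠ 0
  anti : ∀ u v, 0 < u → u ≤ v → F v * G u ≤ F u * G v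
  unb : ∀ M : ℝ≥0, ∃ t0 > 0, ∀ u, 0 < u → u ≤ t0 → M * G u ≤ F u
  unif : ∀ δ b κ : ℝ, 0 < δ → 1 < κ → ∃ τ > 0, ∀ τ' u, 0 < τ' → τ' ≤ τ → δ ≤ u → u ≤ b →
    F (u + τ') ≤ ENNReal.ofReal κ * F u
  rpos : ∀ i, 0 < r i
  spos : ∀ i, 0 < s i
  rs : ∀ᶠ i in atTop, r i ≤ s i
  s0 : Tendsto s atTop (nhds 0)
  Gs : ∀ i, G (s i) = F (r i)
  full : ∀ᵐ y ∂μ, ∃ᶠ i in atTop, y ∈ ball (x i) (s i)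

section core
variable {Y : Type*} [MetricSpace Y] [MeasurableSpace Y] [BorelSpace Y]
  [SecondCountableTopology Y] {μ : Measure Y} [IsLocallyFiniteMeasure μ]
  {F G : ℝ → ℝ≥0∞} {C : ℝ≥0} {R : ℝ} {x : ℕ → Y} {r s : ℕ → ℝ}

lemma MTPData.cover (h : MTPData μ F G C R x r s) (ν : Measure Y) [IsFiniteMeasure ν]
    (hν : ν ≪ μ) (W : Set Y) (hW : IsOpen W) (hνW : ν Wᶜ = 0) (ε : ℝ≥0∞) (hε : ε ≠ 0)
    (τ : ℝ) (hτ : 0 < τ) (N : ℕ) :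
    ∃ T : Finset ℕ, (T : Set ℕ).PairwiseDisjoint (fun i => closedBall (x i) (s i)) ∧
      (∀ i ∈ T, closedBall (x i) (s i) ⊆ W ∧ N ≤ i ∧ r i ≤ s i ∧ s i ≤ R ∧ s i ≤ τ) ∧
      ν Set.univ ≤ ∑ i ∈ T, ν (closedBall (x i) (s i)) + ε := by
  classical
  set t : Set (Y × ℕ) := {a | a.1 ∈ closedBall (x a.2) (s a.2) ∧ closedBall (x a.2) (s a.2) ⊆ W ∧
    N ≤ a.2 ∧ r a.2 ≤ s a.2 ∧ s a.2 ≤ R ∧ s a.2 ≤ τ} with ht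
  obtain ⟨u, hut, huc, hud, hu0⟩ := Vitali.exists_disjoint_covering_ae μ
    (W ∩ {y | ∃ᶠ i in atTop, y ∈ ball (x i) (s i)}) t (C * C) (fun a => 2 * s a.2) (fun a => a.1)
    (fun a => closedBall (x a.2) (s a.2)) (by
      rintro ⟨p, i⟩ ⟨h1, -⟩
      apply closedBall_subset_closedBall'
      simp only [mem_closedBall] at h1
      rw [dist_comm]
      dsimp only
      linarith) (by
      rintro ⟨p, i⟩ ⟨h1, h2, h3, h4, h5, h6⟩
      have h7 := h.spos i
      dsimp only at *
      calc μ (closedBall p (3 * (2 * s i))) ≤ μ (closedBall (x i) (8 * s i)) := by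
            apply measure_mono
            apply closedBall_subset_closedBall'
            simp only [mem_closedBall] at h1
            linarith
        _ ≤ C * G (s i) := h.up _ _ h7 h5
        _ ≤ C * (C * μ (ball (x i) (s i / 2))) := by gcongr; exact h.low _ _ h7 h5
        _ ≤ (C * C : ℝ≥0) * μ (closedBall (x i) (s i)) := by
            rw [ENNReal.coe_mul, mul_assoc]
            gcongr
            exact (ball_subset_ball (by linarith)).trans ball_subset_closedBall) (by
      rintro ⟨p, i⟩ -
      exact ⟨x i, interior_mono ball_subset_closedBall
        (by rw [isOpen_ball.interior_eq]; exact mem_ball_self (h.spos i))⟩) (by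
      rintro ⟨p, i⟩ -
      exact isClosed_closedBall) (by
      rintro p ⟨hpW, hpf⟩ e he
      obtain ⟨d, hd, hdW⟩ := Metric.isOpen_iff.1 hW p hpW
      have hm : 0 < min (min (e / 2) (d / 2)) (min R τ) := by
        have := h.R_pos
        positivity
      have ev : ∀ᶠ i in atTop, s i < min (min (e / 2) (d / 2)) (min R τ) :=
        h.s0.eventually (gt_mem_nhds hm)
      obtain ⟨i, hi, hi1, hi2, hi3⟩ := (hpf.and_eventually
        (ev.and (h.rs.and (eventually_ge_atTop N)))).exists
      simp only [lt_min_iff] at hi1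
      obtain ⟨⟨q1, q2⟩, q3, q4⟩ := hi1
      refine ⟨(p, i), ⟨ball_subset_closedBall hi, ?_, hi3, hi2, q3.le, q4.le⟩, by dsimp only; linarith, rfl⟩
      refine Set.Subset.trans ?_ hdW
      intro z hz
      simp only [mem_ball, mem_closedBall] at *
      linarith [dist_triangle_right z p (x i)])
  have hfull : ν (⋃ a ∈ u, closedBall (x a.2) (s a.2))ᶜ = 0 := by
    have h1 := hν hu0
    have h2 : ν {y | ∃ᶠ i in atTop, y ∈ ball (x i) (s i)}ᶜ = 0 := hν h.full
    refine measure_mono_null ?_ (measure_union_null hνW (measure_union_null h2 h1))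
    intro y hy
    by_cases a1 : y ∈ W
    · by_cases a2 : y ∈ {y | ∃ᶠ i in atTop, y ∈ ball (x i) (s i)}
      · exact Or.inr (Or.inr ⟨⟨a1, a2⟩, hy⟩)
      · exact Or.inr (Or.inl a2)
    · exact Or.inl a1
  have hsum : ν Set.univ = ∑' a : u, ν (closedBall (x a.1.2) (s a.1.2)) := by
    rw [← measure_biUnion huc hud (fun a _ => isClosed_closedBall.measurableSet)]
    exact (measure_congr (by rw [ae_eq_univ]; exact hfull)).symm
  have hfin : ∃ T : Finset u, ν Set.univ ≤ ∑ a ∈ T, ν (closedBall (x a.1.2) (s a.1.2)) + ε := by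
    by_cases h0 : ν Set.univ = 0
    · exact ⟨∅, by simp [h0]⟩
    have h1 : ν Set.univ - ε < ∑' a : u, ν (closedBall (x a.1.2) (s a.1.2)) := by
      rw [← hsum]
      exact ENNReal.sub_lt_self (measure_ne_top _ _) h0 hε
    rw [ENNReal.tsum_eq_iSup_sum, lt_iSup_iff] at h1
    obtain ⟨T, hT⟩ := h1
    exact ⟨T, tsub_le_iff_right.1 hT.le⟩
  obtain ⟨T, hT⟩ := hfin
  have hinj : ∀ a b : u, a.1.2 = b.1.2 → a = b := by
    intro a b hab
    by_contra hne
    have := hud a.2 b.2 (fun hh => hne (Subtype.ext hh))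
    have h3 : x a.1.2 ∈ closedBall (x a.1.2) (s a.1.2) := mem_closedBall_self (h.spos _).le
    exact Set.disjoint_left.1 this h3 (by rw [hab] at h3 ⊢; exact h3)
  refine ⟨T.image (fun a => a.1.2), ?_, ?_, ?_⟩
  · intro i hi j hj hij
    simp only [Finset.coe_image, Set.mem_image] at hi hj
    obtain ⟨a, -, rfl⟩ := hi
    obtain ⟨b, -, rfl⟩ := hj
    exact hud a.2 b.2 (fun hh => hij (by rw [hh]))
  · intro i hi
    simp only [Finset.mem_image] at hi
    obtain ⟨a, -, rfl⟩ := hi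
    exact (hut a.2).2
  · rw [Finset.sum_image (fun a _ b _ hab => hinj a b hab)]
    exact hT

lemma MTPData.single (h : MTPData μ F G C R x r s) (ν : Measure Y) [IsFiniteMeasure ν] (D : ℝ≥0)
    (hD : ν ≤ D • μ) (W : Set Y) (hW : IsOpen W) (hνW : ν Wᶜ = 0) (ε : ℝ≥0∞) (hε : ε ≠ 0)
    (τ : ℝ) (hτ : 0 < τ) (N : ℕ) :
    ∃ (ν' : Measure Y) (W' : Set Y) (D' : ℝ≥0), IsFiniteMeasure ν' ∧ ν' ≤ D' • μ ∧ IsOpen W' ∧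
      ν' W'ᶜ = 0 ∧ closure W' ⊆ W ∩ ⋃ i ≥ N, ball (x i) (r i) ∧ ν Set.univ ≤ ν' Set.univ + ε ∧
      (∀ y u, 0 < u → ν' (closedBall y u) ≤ ν (closedBall y (u + τ))) ∧
      (∀ y u, 0 < u → u ≤ R → ν' (closedBall y u) ≤ (((C + C ^ 3) * D : ℝ≥0)) * (F u + G u)) := by
  classical
  have hac : ν ≪ μ := (Measure.absolutelyContinuous_of_le hD).trans
    Measure.smul_absolutelyContinuous
  obtain ⟨T, hTd, hT, hTsum⟩ := h.cover ν hac W hW hνW ε hε (τ / 2) (by positivity) N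
  set w : ℕ → ℝ≥0∞ := fun i => ν (closedBall (x i) (s i)) / μ (ball (x i) (r i / 2)) with hw
  have hb0 : ∀ i ∈ T, μ (ball (x i) (r i / 2)) ≠ 0 := by
    intro i hi h0
    obtain ⟨h1, h2, h3, h4, h5⟩ := hT i hi
    have := h.low (x i) (r i) (h.rpos i) (by linarith)
    rw [h0, mul_zero] at this
    exact h.Gpos _ (h.rpos i) (le_antisymm this bot_le)
  have hupfin : ∀ y t, 0 < t → t ≤ R → μ (closedBall y (8 * t)) ≠ ⊤ := fun y t h1 h2 =>
    ne_top_of_le_ne_top (ENNReal.mul_ne_top ENNReal.coe_ne_top (h.Gfin t)) (h.up y t h1 h2)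
  have hbt : ∀ i ∈ T, μ (ball (x i) (r i / 2)) ≠ ⊤ := by
    intro i hi
    obtain ⟨h1, h2, h3, h4, h5⟩ := hT i hi
    have := h.rpos i
    refine ne_top_of_le_ne_top (hupfin (x i) (r i) (h.rpos i) (by linarith)) (measure_mono ?_)
    exact (ball_subset_ball (by linarith)).trans ball_subset_closedBall
  have hwμ : ∀ i ∈ T, w i * μ (ball (x i) (r i / 2)) = ν (closedBall (x i) (s i)) :=
    fun i hi => ENNReal.div_mul_cancel (hb0 i hi) (hbt i hi)
  have hwt : ∀ i ∈ T, w i ≠ ⊤ := fun i hi => ENNReal.div_ne_top (measure_ne_top _ _) (hb0 i hi)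
  set ν' : Measure Y := ∑ i ∈ T, w i • μ.restrict (ball (x i) (r i / 2)) with hν'
  have happ : ∀ S, ν' S = ∑ i ∈ T, w i * μ (S ∩ ball (x i) (r i / 2)) := by
    intro S
    rw [hν', Measure.finsetSum_apply]
    refine Finset.sum_congr rfl fun i _ => ?_
    rw [Measure.smul_apply, Measure.restrict_apply' isOpen_ball.measurableSet, smul_eq_mul]
  have huniv : ν' Set.univ = ∑ i ∈ T, ν (closedBall (x i) (s i)) := by
    rw [happ]
    refine Finset.sum_congr rfl fun i hi => ?_
    rw [Set.univ_inter, hwμ i hi]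
  -- transport bound
  have htrans : ∀ S Z : Set Y, (∀ i ∈ T, (S ∩ ball (x i) (r i / 2)).Nonempty →
      closedBall (x i) (s i) ⊆ Z) → ν' S ≤ ν Z := by
    intro S Z hSZ
    rw [happ]
    set T' := T.filter (fun i => (S ∩ ball (x i) (r i / 2)).Nonempty) with hT'
    calc ∑ i ∈ T, w i * μ (S ∩ ball (x i) (r i / 2))
        = ∑ i ∈ T', w i * μ (S ∩ ball (x i) (r i / 2)) := by
          symm
          apply Finset.sum_filter_of_ne
          intro i _ hne
          by_contra hemp
          rw [Set.not_nonempty_iff_eq_empty] at hemp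
          simp [hemp] at hne
      _ ≤ ∑ i ∈ T', ν (closedBall (x i) (s i)) := by
          refine Finset.sum_le_sum fun i hi => ?_
          rw [← hwμ i (Finset.mem_filter.1 hi).1]
          gcongr
          exact Set.inter_subset_right
      _ = ν (⋃ i ∈ T', closedBall (x i) (s i)) := by
          rw [measure_biUnion_finset (hTd.subset (by intro i hi; exact (Finset.mem_filter.1 hi).1))
            (fun i _ => isClosed_closedBall.measurableSet)]
      _ ≤ ν Z := measure_mono (Set.iUnion₂_subset fun i hi =>
          hSZ i (Finset.mem_filter.1 hi).1 (Finset.mem_filter.1 hi).2)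
  have htouch : ∀ y u i, (closedBall y u ∩ ball (x i) (r i / 2)).Nonempty →
      dist (x i) y ≤ r i / 2 + u := by
    rintro y u i ⟨z, h1, h2⟩
    simp only [mem_ball, mem_closedBall] at *
    linarith [dist_triangle_left (x i) y z]
  refine ⟨ν', ⋃ i ∈ T, ball (x i) (r i / 2), ∑ i ∈ T, (w i).toNNReal, ?_, ?_, ?_, ?_, ?_, ?_, ?_, ?_⟩
  · refine ⟨?_⟩
    rw [huniv]
    exact ENNReal.sum_lt_top.2 fun i _ => measure_lt_top _ _
  · refine Measure.le_intro fun S _ _ => ?_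
    rw [happ, Measure.smul_apply, ENNReal.smul_def, ENNReal.ofNNReal_finsetSum, smul_eq_mul,
      Finset.sum_mul]
    refine Finset.sum_le_sum fun i hi => ?_
    rw [ENNReal.coe_toNNReal (hwt i hi)]
    gcongr
    exact Set.inter_subset_left
  · exact isOpen_biUnion fun i _ => isOpen_ball
  · rw [happ]
    refine Finset.sum_eq_zero fun i hi => ?_
    have : (⋃ i ∈ T, ball (x i) (r i / 2))ᶜ ∩ ball (x i) (r i / 2) = ∅ := by
      rw [Set.eq_empty_iff_forall_notMem]
      rintro z ⟨h1, h2⟩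
      exact h1 (Set.mem_biUnion hi h2)
    rw [this, measure_empty, mul_zero]
  · rw [Finset.closure_biUnion]
    refine Set.iUnion₂_subset fun i hi => ?_
    obtain ⟨h1, h2, h3, h4, h5⟩ := hT i hi
    have h6 := h.rpos i
    refine closure_ball_subset_closedBall.trans (Set.subset_inter ?_ ?_)
    · exact (closedBall_subset_closedBall (by linarith)).trans h1
    · exact (closedBall_subset_ball (by linarith)).trans
        (Set.subset_biUnion_of_mem (u := fun i => ball (x i) (r i)) (show i ∈ {i | i ≥ N} from h2))
  · rw [huniv]; exact hTsum
  · intro y u hu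
    refine htrans _ _ fun i hi hne => ?_
    obtain ⟨h1, h2, h3, h4, h5⟩ := hT i hi
    apply closedBall_subset_closedBall'
    have := htouch y u i hne
    have h6 := h.rpos i
    linarith
  · intro y u hu huR
    by_cases hex : ∃ i ∈ T, (closedBall y u ∩ ball (x i) (r i / 2)).Nonempty ∧ 4 * u ≤ s i
    · obtain ⟨i, hi, hne, hus⟩ := hex
      obtain ⟨h1, h2, h3, h4, h5⟩ := hT i hi
      have h6 := h.rpos i
      have h7 := h.spos i
      have hsub : closedBall y u ⊆ closedBall (x i) (s i) := by
        apply closedBall_subset_closedBall'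
        have := htouch y u i hne
        rw [dist_comm]
        linarith
      have hone : ν' (closedBall y u) = w i * μ (closedBall y u ∩ ball (x i) (r i / 2)) := by
        rw [happ]
        refine Finset.sum_eq_single_of_mem i hi fun j hj hji => ?_
        have : closedBall y u ∩ ball (x j) (r j / 2) = ∅ := by
          rw [Set.eq_empty_iff_forall_notMem]
          rintro z ⟨q1, q2⟩
          refine Set.disjoint_left.1 (hTd hj hi hji) (ball_subset_closedBall ?_) (hsub q1)
          have := (hT j hj).2.2.1
          have := h.rpos j
          exact ball_subset_ball (by linarith) q2
        simp [this]
      have hνi : ν (closedBall (x i) (s i)) ≤ D * (C * F (r i)) := by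
        calc ν (closedBall (x i) (s i)) ≤ D * μ (closedBall (x i) (s i)) := hD _
          _ ≤ D * μ (closedBall (x i) (8 * s i)) := by
              gcongr; linarith
          _ ≤ D * (C * G (s i)) := by gcongr; exact h.up _ _ h7 h4
          _ = _ := by rw [h.Gs]
      have hA : ν' (closedBall y u) ≤ (C + C ^ 3 : ℝ≥0) * D * F u := by
        rw [hone]
        rcases le_total (r i) u with hru | hru
        · calc w i * μ (closedBall y u ∩ ball (x i) (r i / 2))
              ≤ w i * μ (ball (x i) (r i / 2)) := by gcongr; exact Set.inter_subset_right
            _ ≤ D * (C * F (r i)) := by rw [hwμ i hi]; exact hνi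
            _ ≤ D * (C * F u) := by gcongr; exact h.Fmono _ _ h6 hru
            _ = C * D * F u := by ring
            _ ≤ _ := by gcongr; exact le_self_add
        · have k1 : w i * G u ≤ C ^ 2 * D * F u := by
            have k2 : w i * G u * G (r i) ≤ C ^ 2 * D * F u * G (r i) := by
              calc w i * G u * G (r i) ≤ w i * G u * (C * μ (ball (x i) (r i / 2))) := by
                    gcongr; exact h.low _ _ h6 (by linarith)
                _ = (w i * μ (ball (x i) (r i / 2))) * (C * G u) := by ring
                _ ≤ (D * (C * F (r i))) * (C * G u) := by rw [hwμ i hi]; gcongr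
                _ = C ^ 2 * D * (F (r i) * G u) := by ring
                _ ≤ C ^ 2 * D * (F u * G (r i)) := mul_le_mul' le_rfl (h.anti _ _ hu hru)
                _ = _ := by ring
            exact (ENNReal.mul_le_mul_iff_left (h.Gpos _ h6) (h.Gfin _)).1 k2
          calc w i * μ (closedBall y u ∩ ball (x i) (r i / 2))
              ≤ w i * μ (closedBall y (8 * u)) := by
                gcongr
                exact Set.inter_subset_left.trans (closedBall_subset_closedBall (by linarith))
            _ ≤ w i * (C * G u) := by gcongr; exact h.up _ _ hu huR
            _ = C * (w i * G u) := by ring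
            _ ≤ C * (C ^ 2 * D * F u) := by gcongr
            _ = (C ^ 3 : ℝ≥0) * D * F u := by push_cast; ring
            _ ≤ _ := by gcongr; exact le_add_self
      refine hA.trans ?_
      rw [ENNReal.coe_mul]
      gcongr
      exact le_self_add
    · push Not at hex
      have : ν' (closedBall y u) ≤ ν (closedBall y (8 * u)) := by
        refine htrans _ _ fun i hi hne => ?_
        have h1 := hex i hi hne
        have h2 := (hT i hi).2.2.1
        have h3 := htouch y u i hne
        apply closedBall_subset_closedBall'
        linarith
      calc ν' (closedBall y u) ≤ ν (closedBall y (8 * u)) := this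
        _ ≤ D * μ (closedBall y (8 * u)) := hD _
        _ ≤ D * (C * G u) := by gcongr; exact h.up _ _ hu huR
        _ = C * D * G u := by ring
        _ ≤ _ := by
            rw [ENNReal.coe_mul]
            gcongr
            · exact le_self_add
            · exact le_add_self

lemma MTPData.multi (h : MTPData μ F G C R x r s) (ν : Measure Y) [IsFiniteMeasure ν] (D : ℝ≥0)
    (hD1 : 1 ≤ D)
    (hD : ν ≤ D • μ) (W : Set Y) (hW : IsOpen W) (hνW : ν Wᶜ = 0) (ε : ℝ≥0∞) (hε : ε ≠ 0)
    (τ : ℝ) (hτ : 0 < τ) (N : ℕ) (K : ℕ) :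
    ∃ (ν' : Measure Y) (W' : Set Y) (D' : ℝ≥0), IsFiniteMeasure ν' ∧ ν' ≤ D' • μ ∧ IsOpen W' ∧
      ν' W'ᶜ = 0 ∧ closure W' ⊆ W ∩ ⋃ i ≥ N, ball (x i) (r i) ∧
      K * ν Set.univ ≤ ν' Set.univ + K * ε ∧
      (∀ y u, 0 < u → ν' (closedBall y u) ≤ K * ν (closedBall y (u + τ))) ∧
      (∀ y u, 0 < u → u ≤ R → ν' (closedBall y u) ≤
        ((C + C ^ 3) * D : ℝ≥0) * (2 * F u + K * G u)) := by
  induction K with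
  | zero =>
    refine ⟨0, ∅, 0, inferInstance, ?_, isOpen_empty, ?_, ?_, ?_, ?_, ?_⟩ <;> simp
  | succ K ih =>
    obtain ⟨σ, V, E, i1, i2, i3, i4, i5, i6, i7, i8⟩ := ih
    have hC1 := h.C_one
    set A : ℝ≥0 := (C + C ^ 3) * D with hA
    have hA1 : C * D ≤ A := by
      rw [hA]; gcongr; exact le_self_add
    have hA2 : 1 ≤ A := le_trans (one_le_mul hC1 hD1) hA1
    obtain ⟨t0, ht0, hunb⟩ := h.unb (E * C)
    obtain ⟨ν', V', E', j1, j2, j3, j4, j5, j6, j7, j8⟩ :=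
      h.single ν D hD W hW hνW ε hε (min τ t0) (lt_min hτ ht0) N
    refine ⟨σ + ν', V ∪ V', E + E', inferInstance, ?_, i3.union j3, ?_, ?_, ?_, ?_, ?_⟩
    · rw [add_smul]; exact add_le_add i2 j2
    · rw [Measure.add_apply, add_eq_zero]
      exact ⟨measure_mono_null (by simp) i4, measure_mono_null (by simp) j4⟩
    · rw [closure_union]; exact Set.union_subset i5 j5
    · rw [Measure.add_apply]
      push_cast
      calc ((K : ℝ≥0∞) + 1) * ν Set.univ = K * ν Set.univ + ν Set.univ := by ring
        _ ≤ (σ Set.univ + K * ε) + (ν' Set.univ + ε) := add_le_add i6 j6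
        _ = _ := by ring
    · intro y u hu
      rw [Measure.add_apply]
      push_cast
      rw [add_mul, one_mul]
      refine add_le_add (i7 y u hu) ((j7 y u hu).trans (measure_mono ?_))
      apply closedBall_subset_closedBall
      linarith [min_le_left τ t0]
    · intro y u hu huR
      rw [Measure.add_apply]
      push_cast
      rcases le_or_gt u t0 with hut | hut
      · have k1 : σ (closedBall y u) ≤ A * F u := by
          calc σ (closedBall y u) ≤ E * μ (closedBall y u) := i2 _
            _ ≤ E * μ (closedBall y (8 * u)) := by gcongr; linarith
            _ ≤ E * (C * G u) := by gcongr; exact h.up _ _ hu huR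
            _ = (E * C : ℝ≥0) * G u := by push_cast; ring
            _ ≤ F u := hunb u hu hut
            _ ≤ A * F u := le_mul_of_one_le_left' (by exact_mod_cast hA2)
        calc σ (closedBall y u) + ν' (closedBall y u) ≤ A * F u + A * (F u + G u) :=
              add_le_add k1 (j8 y u hu huR)
          _ = A * (2 * F u + 1 * G u) := by ring
          _ ≤ _ := by gcongr; exact le_add_self
      · have k1 : ν' (closedBall y u) ≤ A * G u := by
          calc ν' (closedBall y u) ≤ ν (closedBall y (u + min τ t0)) := j7 y u hu
            _ ≤ ν (closedBall y (8 * u)) := by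
                apply measure_mono
                apply closedBall_subset_closedBall
                linarith [min_le_right τ t0]
            _ ≤ D * μ (closedBall y (8 * u)) := hD _
            _ ≤ D * (C * G u) := by gcongr; exact h.up _ _ hu huR
            _ = (C * D : ℝ≥0) * G u := by push_cast; ring
            _ ≤ A * G u := by gcongr
        calc σ (closedBall y u) + ν' (closedBall y u) ≤ A * (2 * F u + K * G u) + A * G u :=
              add_le_add (i8 y u hu huR) k1
          _ = _ := by ring

/-- The invariant of the construction. -/
def MTPInv (μ : Measure Y) (F : ℝ → ℝ≥0∞) (η : ℝ≥0) (R₁ : ℝ) (m : ℝ≥0∞)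
    (p : Measure Y × Set Y) : Prop :=
  IsFiniteMeasure p.1 ∧ (∃ D : ℝ≥0, 1 ≤ D ∧ p.1 ≤ D • μ) ∧ IsOpen p.2 ∧ p.1 p.2ᶜ = 0 ∧
    m < p.1 Set.univ ∧ ∃ θ : ℝ, 1 < θ ∧ ∀ y u, 0 < u → u ≤ θ * R₁ →
      ENNReal.ofReal θ * p.1 (closedBall y u) ≤ η * F u

lemma MTPData.step (h : MTPData μ F G C R x r s) {η : ℝ≥0} (hη : 0 < η) {R₁ : ℝ} (hR₁ : 0 < R₁)
    {m : ℝ≥0∞} (p : Measure Y × Set Y) (hp : MTPInv μ F η R₁ m p) (N : ℕ) :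
    ∃ q, MTPInv μ F η R₁ m q ∧ closure q.2 ⊆ p.2 ∩ ⋃ i ≥ N, ball (x i) (r i) := by
  obtain ⟨ν, W⟩ := p
  obtain ⟨p1, ⟨D, hD1, hD⟩, hW, hνW, hm, θ, hθ, hQ⟩ := hp
  dsimp only at *
  set A : ℝ≥0 := (C + C ^ 3) * D with hA
  set θ' : ℝ := (1 + θ) / 2 with hθ'
  have hθ1 : 1 < θ' := by rw [hθ']; linarith
  have hθ2 : θ' < θ := by rw [hθ']; linarith
  set T : ℝ≥0 := θ'.toNNReal with hT
  have hT' : ENNReal.ofReal θ' = T := rfl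
  obtain ⟨t0, ht0, hunb⟩ := h.unb (2 * T * A / η)
  obtain ⟨K0, hK0⟩ := exists_nat_ge (4 * T * A / η)
  set K : ℕ := K0 + 1 with hK
  have hKη : 4 * T * A ≤ η * K := by
    have : 4 * T * A / η ≤ K := hK0.trans (by rw [hK]; push_cast; exact le_self_add)
    rw [div_le_iff₀ hη] at this
    rwa [mul_comm η]
  set δ := min t0 R with hδ
  have hδ0 : 0 < δ := lt_min ht0 h.R_pos
  obtain ⟨τ, hτ, hunif⟩ := h.unif δ (θ' * R₁) (θ / θ') hδ0 (by rw [one_lt_div (by linarith)]; exact hθ2)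
  set τ' := min τ ((θ - θ') * R₁) with hτ'
  have hτ'0 : 0 < τ' := lt_min hτ (mul_pos (by linarith) hR₁)
  obtain ⟨ε, hε0, hε⟩ : ∃ ε : ℝ≥0∞, ε ≠ 0 ∧ m + ε < ν Set.univ := by
    obtain ⟨ε, hε0, hε⟩ := ENNReal.lt_iff_exists_add_pos_lt.1 hm
    exact ⟨ε, by simpa using hε0.ne', hε⟩
  obtain ⟨σ, V, E, i1, i2, i3, i4, i5, i6, i7, i8⟩ :=
    h.multi ν D hD1 hD W hW hνW ε hε0 τ' hτ'0 N K
  have hKne : (K : ℝ≥0∞) ≠ 0 := by rw [hK]; simp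
  have hKt : (K : ℝ≥0∞) ≠ ⊤ := ENNReal.natCast_ne_top K
  have hKnn : (K : ℝ≥0) ≠ 0 := by rw [hK]; positivity
  have hKinv : ((K : ℝ≥0)⁻¹ : ℝ≥0) * (K : ℝ≥0∞) = 1 := by
    rw [ENNReal.coe_inv hKnn]
    exact ENNReal.inv_mul_cancel hKne hKt
  have happ : ∀ S, ((K : ℝ≥0)⁻¹ • σ) S = ((K : ℝ≥0)⁻¹ : ℝ≥0) * σ S := fun S => rfl
  refine ⟨((K : ℝ≥0)⁻¹ • σ, V), ⟨?_, ⟨max 1 E, le_max_left _ _, ?_⟩, i3, ?_, ?_, θ', hθ1, ?_⟩, i5⟩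
  · dsimp only; infer_instance
  · dsimp only
    refine Measure.le_intro fun S _ _ => ?_
    rw [happ]
    calc ((K : ℝ≥0)⁻¹ : ℝ≥0) * σ S ≤ 1 * σ S := by
          gcongr
          rw [← ENNReal.coe_one, ENNReal.coe_le_coe]
          apply inv_le_one_of_one_le₀
          rw [hK]; push_cast; exact le_add_self
      _ ≤ E * μ S := by rw [one_mul]; exact i2 S
      _ ≤ (max 1 E : ℝ≥0) * μ S := by gcongr; exact le_max_right _ _
  · dsimp only; rw [happ, i4, mul_zero]
  · dsimp only
    rw [happ]
    have h1 : ν Set.univ ≤ ((K : ℝ≥0)⁻¹ : ℝ≥0) * σ Set.univ + ε := by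
      calc ν Set.univ = ((K : ℝ≥0)⁻¹ : ℝ≥0) * (K * ν Set.univ) := by
            rw [← mul_assoc, hKinv, one_mul]
        _ ≤ ((K : ℝ≥0)⁻¹ : ℝ≥0) * (σ Set.univ + K * ε) := by gcongr
        _ = ((K : ℝ≥0)⁻¹ : ℝ≥0) * σ Set.univ + (((K : ℝ≥0)⁻¹ : ℝ≥0) * K) * ε := by ring
        _ = _ := by rw [hKinv, one_mul]
    exact lt_of_add_lt_add_right (hε.trans_le h1)
  · intro y u hu huR
    dsimp only
    rw [happ, hT']
    rcases le_or_gt u δ with hud | hud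
    · have k1 := i8 y u hu (hud.trans (min_le_right _ _))
      have k2 := hunb u hu (hud.trans (min_le_left _ _))
      have k3 : 2 * (T * A * G u) ≤ η * F u := by
        calc 2 * ((T : ℝ≥0∞) * A * G u) = η * ((2 * T * A / η : ℝ≥0) * G u) := by
              rw [← mul_assoc (η : ℝ≥0∞), ← ENNReal.coe_mul η, mul_div_cancel₀ _ hη.ne']
              push_cast; ring
          _ ≤ _ := by gcongr
      have k4 : 2 * (((K : ℝ≥0)⁻¹ : ℝ≥0) * (T * A * (2 * F u))) ≤ η * F u := by
        calc 2 * ((((K : ℝ≥0)⁻¹ : ℝ≥0) : ℝ≥0∞) * (T * A * (2 * F u)))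
            = ((K : ℝ≥0)⁻¹ : ℝ≥0) * ((4 * T * A : ℝ≥0) * F u) := by push_cast; ring
          _ ≤ ((K : ℝ≥0)⁻¹ : ℝ≥0) * ((η * K : ℝ≥0) * F u) := by gcongr
          _ = (((K : ℝ≥0)⁻¹ : ℝ≥0) * K) * (η * F u) := by push_cast; ring
          _ = _ := by rw [hKinv, one_mul]
      have k5 : T * ((((K : ℝ≥0)⁻¹ : ℝ≥0) : ℝ≥0∞) * σ (closedBall y u)) ≤
          ((K : ℝ≥0)⁻¹ : ℝ≥0) * (T * A * (2 * F u)) + T * A * G u := by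
        calc T * ((((K : ℝ≥0)⁻¹ : ℝ≥0) : ℝ≥0∞) * σ (closedBall y u))
            ≤ T * ((((K : ℝ≥0)⁻¹ : ℝ≥0) : ℝ≥0∞) * (A * (2 * F u + K * G u))) := by gcongr
          _ = ((K : ℝ≥0)⁻¹ : ℝ≥0) * (T * A * (2 * F u)) +
              (((K : ℝ≥0)⁻¹ : ℝ≥0) * K) * (T * A * G u) := by ring
          _ = _ := by rw [hKinv, one_mul]
      refine k5.trans ?_
      rw [← ENNReal.mul_le_mul_iff_right (a := 2) (by simp) (by simp), mul_add, two_mul (_ * F u)]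
      exact add_le_add k4 k3
    · have k1 := i7 y u hu
      have k2 := hunif τ' u hτ'0 (min_le_left _ _) hud.le huR
      have k3 : u + τ' ≤ θ * R₁ := by
        have := min_le_right τ ((θ - θ') * R₁)
        rw [← hτ'] at this
        nlinarith
      have k4 := hQ y (u + τ') (by linarith) k3
      have k5 : ENNReal.ofReal θ = T * ENNReal.ofReal (θ / θ') := by
        rw [← hT', ← ENNReal.ofReal_mul (by linarith), mul_div_cancel₀ _ (by linarith)]
      have hκ0 : ENNReal.ofReal (θ / θ') ≠ 0 := by
        have : 0 < θ / θ' := div_pos (by linarith) (by linarith)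
        simpa using this
      rw [← ENNReal.mul_le_mul_iff_right hκ0 ENNReal.ofReal_ne_top]
      calc ENNReal.ofReal (θ / θ') * (T * (((K : ℝ≥0)⁻¹ : ℝ≥0) * σ (closedBall y u)))
          ≤ ENNReal.ofReal (θ / θ') * (T * (((K : ℝ≥0)⁻¹ : ℝ≥0) * (K * ν (closedBall y (u + τ'))))) := by
            gcongr
        _ = (T * ENNReal.ofReal (θ / θ')) * ((((K : ℝ≥0)⁻¹ : ℝ≥0) * K) * ν (closedBall y (u + τ'))) := by
            ring
        _ = ENNReal.ofReal θ * ν (closedBall y (u + τ')) := by rw [hKinv, one_mul, k5]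
        _ ≤ η * F (u + τ') := k4
        _ ≤ η * (ENNReal.ofReal (θ / θ') * F u) := by gcongr
        _ = _ := by ring

lemma MTPData.seq (h : MTPData μ F G C R x r s) {η : ℝ≥0} (hη : 0 < η) {R₁ : ℝ} (hR₁ : 0 < R₁)
    {m : ℝ≥0∞} (p : Measure Y × Set Y) (hp : MTPInv μ F η R₁ m p) :
    ∃ q : ℕ → Measure Y × Set Y, q 0 = p ∧ (∀ n, MTPInv μ F η R₁ m (q n)) ∧
      ∀ n, closure (q (n + 1)).2 ⊆ (q n).2 ∩ ⋃ i ≥ n, ball (x i) (r i) := by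
  choose! nx hnx1 hnx2 using fun (p : Measure Y × Set Y) (N : ℕ) (hp : MTPInv μ F η R₁ m p) =>
    h.step hη hR₁ p hp N
  let q : ℕ → Measure Y × Set Y := fun n => Nat.rec p (fun k a => nx a k) n
  have hq : ∀ n, MTPInv μ F η R₁ m (q n) := by
    intro n
    induction n with
    | zero => exact hp
    | succ n ih => exact hnx1 _ _ ih
  exact ⟨q, rfl, hq, fun n => hnx2 _ _ (hq n)⟩

/-- Mass distribution along a decreasing sequence of compact sets. -/
lemma mass_distribution (f : ℝ → ℝ) (hf : ContinuousOn f (Set.Ioi 0))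
    (hf0 : Tendsto f (nhdsWithin 0 (Set.Ioi 0)) (nhds 0))
    (q : ℕ → Measure Y × Set Y) (Z : Set Y) (hZ : IsCompact Z) (hZ0 : (q 0).2 ⊆ Z)
    (hq : ∀ n, closure (q (n + 1)).2 ⊆ (q n).2) (η : ℝ≥0) (m : ℝ≥0∞) (R₁ : ℝ) (hR₁ : 0 < R₁)
    (hc : ∀ n, (q n).1 (q n).2ᶜ = 0) (hm : ∀ n, m ≤ (q n).1 Set.univ)
    (hb : ∀ n y u, 0 < u → u ≤ R₁ → (q n).1 (closedBall y u) ≤ η * ENNReal.ofReal (f u)) :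
    m / η ≤ Measure.mkMetric (fun d : ℝ≥0∞ => ENNReal.ofReal (f d.toReal))
      (⋂ n, closure (q (n + 1)).2) := by
  have hcomp : ∀ n, IsCompact (closure (q (n + 1)).2) := by
    have : ∀ n, (q n).2 ⊆ Z := by
      intro n
      induction n with
      | zero => exact hZ0
      | succ n ih => exact subset_closure.trans ((hq n).trans ih)
    intro n
    exact hZ.of_isClosed_subset isClosed_closure ((hq n).trans (this n))
  have hanti : Antitone fun n => closure (q (n + 1)).2 :=
    antitone_nat_of_succ_le fun n => (hq (n + 1)).trans subset_closure
  -- covers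
  have key : ∀ t : ℕ → Set Y, (⋂ n, closure (q (n + 1)).2) ⊆ ⋃ j, t j →
      (∀ j, ediam (t j) ≤ ENNReal.ofReal (R₁ / 2)) → ∀ ε : ℝ≥0, 0 < ε →
      m ≤ η * (∑' j, (⨆ _ : (t j).Nonempty, ENNReal.ofReal (f (ediam (t j)).toReal)) + ε) := by
    intro t ht hd ε hε
    obtain ⟨e, he, hesum⟩ := ENNReal.exists_pos_sum_of_countable (ε := ε) (by simpa using hε.ne') ℕ
    have hV : ∀ j, ∃ V : Set Y, IsOpen V ∧ t j ⊆ V ∧ ∀ n, (q n).1 V ≤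
        η * ((⨆ _ : (t j).Nonempty, ENNReal.ofReal (f (ediam (t j)).toReal)) + e j) := by
      intro j
      rcases (t j).eq_empty_or_nonempty with hemp | hne
      · exact ⟨∅, isOpen_empty, by rw [hemp], fun n => by simp⟩
      obtain ⟨y, hy⟩ := hne
      have hfin : ediam (t j) ≠ ⊤ := ne_top_of_le_ne_top ENNReal.ofReal_ne_top (hd j)
      set d := (ediam (t j)).toReal with hdd
      have hd0 : 0 ≤ d := ENNReal.toReal_nonneg
      have hdR : d ≤ R₁ / 2 := ENNReal.toReal_le_of_le_ofReal (by linarith) (hd j)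
      have hin : ∀ z ∈ t j, dist z y ≤ d := by
        intro z hz
        rw [dist_edist]
        exact ENNReal.toReal_mono hfin (edist_le_ediam_of_mem hz hy)
      obtain ⟨d', hd1, hd2, hd3⟩ : ∃ d', d < d' ∧ d' ≤ R₁ ∧
          ENNReal.ofReal (f d') ≤ ENNReal.ofReal (f d) + e j := by
        have hej : (0 : ℝ) < e j := by exact_mod_cast he j
        have ev2 : ∀ᶠ z in nhdsWithin d (Set.Ioi d), z < R₁ :=
          nhdsWithin_le_nhds (gt_mem_nhds (by linarith))
        have ev3 : ∀ᶠ z in nhdsWithin d (Set.Ioi d), d < z := self_mem_nhdsWithin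
        have ev : ∀ᶠ z in nhdsWithin d (Set.Ioi d),
            ENNReal.ofReal (f z) ≤ ENNReal.ofReal (f d) + e j := by
          rcases hd0.eq_or_lt with h0 | h0
          · rw [← h0]
            filter_upwards [hf0.eventually (gt_mem_nhds hej)] with z hz
            refine le_trans ?_ le_add_self
            rw [← ENNReal.ofReal_coe_nnreal]
            exact ENNReal.ofReal_le_ofReal hz.le
          · have hct : ContinuousAt f d := hf.continuousAt (Ioi_mem_nhds h0)
            have := hct.eventually (gt_mem_nhds (show f d < f d + e j by linarith))
            filter_upwards [nhdsWithin_le_nhds this] with z hz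
            rw [← ENNReal.ofReal_coe_nnreal]
            exact (ENNReal.ofReal_le_ofReal hz.le).trans ENNReal.ofReal_add_le
        obtain ⟨z, z1, z2, z3⟩ := (ev.and (ev2.and ev3)).exists
        exact ⟨z, z3, z2.le, z1⟩
      refine ⟨ball y d', isOpen_ball, fun z hz => (hin z hz).trans_lt hd1, fun n => ?_⟩
      calc (q n).1 (ball y d') ≤ (q n).1 (closedBall y d') := measure_mono ball_subset_closedBall
        _ ≤ η * ENNReal.ofReal (f d') := hb n y d' (by linarith) hd2
        _ ≤ _ := by
          gcongr
          refine hd3.trans ?_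
          gcongr
          exact le_iSup_of_le ⟨y, hy⟩ le_rfl
    choose V hVo htV hVm using hV
    obtain ⟨n, hn⟩ : ∃ n, closure (q (n + 1)).2 ⊆ ⋃ j, V j := by
      apply exists_subset_nhds_of_isCompact' (hanti.directed_ge) hcomp
        (fun n => isClosed_closure)
      intro z hz
      have : z ∈ ⋃ j, V j := Set.iUnion_mono htV (ht hz)
      exact (isOpen_iUnion hVo).mem_nhds this
    calc m ≤ (q (n + 1)).1 Set.univ := hm _
      _ ≤ (q (n + 1)).1 ((⋃ j, V j) ∪ (q (n + 1)).2ᶜ) := by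
          apply measure_mono
          intro z _
          by_cases hz : z ∈ (q (n + 1)).2
          · exact Or.inl (hn (subset_closure hz))
          · exact Or.inr hz
      _ ≤ (q (n + 1)).1 (⋃ j, V j) + (q (n + 1)).1 (q (n + 1)).2ᶜ := measure_union_le _ _
      _ = (q (n + 1)).1 (⋃ j, V j) := by rw [hc, add_zero]
      _ ≤ ∑' j, (q (n + 1)).1 (V j) := measure_iUnion_le _
      _ ≤ ∑' j, η * ((⨆ _ : (t j).Nonempty, ENNReal.ofReal (f (ediam (t j)).toReal)) + e j) :=
          ENNReal.tsum_le_tsum fun j => hVm j _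
      _ = η * (∑' j, (⨆ _ : (t j).Nonempty, ENNReal.ofReal (f (ediam (t j)).toReal)) +
            ∑' j, (e j : ℝ≥0∞)) := by rw [ENNReal.tsum_mul_left, ENNReal.tsum_add]
      _ ≤ _ := by gcongr
  have key2 : ∀ t : ℕ → Set Y, (⋂ n, closure (q (n + 1)).2) ⊆ ⋃ j, t j →
      (∀ j, ediam (t j) ≤ ENNReal.ofReal (R₁ / 2)) →
      m / η ≤ (∑' j, (⨆ _ : (t j).Nonempty, ENNReal.ofReal (f (ediam (t j)).toReal))) := by
    intro t ht hd
    refine ENNReal.le_of_forall_pos_le_add fun ε hε _ => ?_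
    exact ENNReal.div_le_of_le_mul' (key t ht hd ε hε)
  rw [Measure.mkMetric_apply]
  refine le_iSup₂_of_le (ENNReal.ofReal (R₁ / 2)) (by simpa using hR₁) ?_
  exact le_iInf fun t => le_iInf fun ht => le_iInf fun hd => key2 t ht hd

lemma MTPData.top [LocallyCompactSpace Y] {f : ℝ → ℝ}
    (h : MTPData μ (fun u => ENNReal.ofReal (f u)) G C R x r s)
    (hf : ContinuousOn f (Set.Ioi 0))
    (hf0 : Tendsto f (nhdsWithin 0 (Set.Ioi 0)) (nhds 0)) (a : Y) (ρ : ℝ) (hρ : 0 < ρ) :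
    Measure.mkMetric (fun d : ℝ≥0∞ => ENNReal.ofReal (f d.toReal))
      (ball a ρ ∩ Filter.limsup (fun i => ball (x i) (r i)) atTop) = ⊤ := by
  obtain ⟨Z, hZ, hZa⟩ := exists_compact_mem_nhds a
  obtain ⟨d, hd, hdZ⟩ := Metric.mem_nhds_iff.1 hZa
  set ρ' := min (min d ρ) R with hρ'
  have hρ'0 : 0 < ρ' := lt_min (lt_min hd hρ) h.R_pos
  have hρR : ρ' ≤ R := min_le_right _ _
  have hμ0 : μ (ball a ρ') ≠ 0 := by
    intro h0
    have h1 := h.low a ρ' hρ'0 hρR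
    have h2 : μ (ball a (ρ' / 2)) = 0 := measure_mono_null (ball_subset_ball (by linarith)) h0
    rw [h2, mul_zero] at h1
    exact h.Gpos _ hρ'0 (le_antisymm h1 bot_le)
  have hμt : μ (ball a ρ') ≠ ⊤ := by
    refine ne_top_of_le_ne_top (ENNReal.mul_ne_top ENNReal.coe_ne_top (h.Gfin ρ'))
      (le_trans (measure_mono ?_) (h.up a ρ' hρ'0 hρR))
    exact ball_subset_closedBall.trans (closedBall_subset_closedBall (by linarith))
  set m := μ (ball a ρ') / 2 with hm
  have hm0 : m ≠ 0 := by simp [hm, hμ0]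
  have hmlt : m < μ (ball a ρ') := ENNReal.half_lt_self hμ0 hμt
  have main : ∀ η : ℝ≥0, 0 < η → m / η ≤ Measure.mkMetric
      (fun d : ℝ≥0∞ => ENNReal.ofReal (f d.toReal))
      (ball a ρ ∩ Filter.limsup (fun i => ball (x i) (r i)) atTop) := by
    intro η hη
    obtain ⟨t0, ht0, hunb⟩ := h.unb (2 * C / η)
    set R₁ := min t0 R / 2 with hR₁
    have hR₁0 : 0 < R₁ := half_pos (lt_min ht0 h.R_pos)
    have hinv : MTPInv μ (fun u => ENNReal.ofReal (f u)) η R₁ m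
        (μ.restrict (ball a ρ'), ball a ρ') := by
      refine ⟨⟨?_⟩, ⟨1, le_rfl, ?_⟩, isOpen_ball, ?_, ?_, 2, by norm_num, ?_⟩
      · rw [Measure.restrict_apply_univ]; exact hμt.lt_top
      · rw [one_smul]; exact Measure.restrict_le_self
      · dsimp only
        rw [Measure.restrict_apply' isOpen_ball.measurableSet]; simp
      · dsimp only
        rwa [Measure.restrict_apply_univ]
      · intro y u hu hur
        have hur' : u ≤ min t0 R := by rw [hR₁] at hur; linarith
        dsimp only
        calc ENNReal.ofReal 2 * μ.restrict (ball a ρ') (closedBall y u)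
            ≤ ENNReal.ofReal 2 * μ (closedBall y (8 * u)) := 
              mul_le_mul' le_rfl ((Measure.restrict_apply_le _ _).trans
                (measure_mono (closedBall_subset_closedBall (by linarith))))
          _ ≤ ENNReal.ofReal 2 * (C * G u) := by
              gcongr; exact h.up _ _ hu (hur'.trans (min_le_right _ _))
          _ = η * ((2 * C / η : ℝ≥0) * G u) := by
              rw [← mul_assoc (η : ℝ≥0∞), ← ENNReal.coe_mul η, mul_div_cancel₀ _ hη.ne']
              push_cast
              rw [ENNReal.ofReal_ofNat]; ring
          _ ≤ _ := by gcongr; exact hunb u hu (hur'.trans (min_le_left _ _))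
    obtain ⟨q, hq0, hqi, hqs⟩ := h.seq hη hR₁0 _ hinv
    have := mass_distribution f hf hf0 q Z hZ (by
        rw [hq0]; exact (ball_subset_ball ((min_le_left _ _).trans (min_le_left _ _))).trans hdZ)
      (fun n => (hqs n).trans Set.inter_subset_left) η m R₁ hR₁0 (fun n => (hqi n).2.2.2.1)
      (fun n => (hqi n).2.2.2.2.1.le) (by
        intro n y u hu huR
        obtain ⟨θ, hθ, hb⟩ := (hqi n).2.2.2.2.2
        refine le_trans ?_ (hb y u hu (by nlinarith))
        refine le_mul_of_one_le_left' ?_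
        rw [← ENNReal.ofReal_one]
        exact ENNReal.ofReal_le_ofReal hθ.le)
    refine this.trans (measure_mono ?_)
    intro z hz
    rw [Set.mem_iInter] at hz
    refine ⟨?_, ?_⟩
    · have := (hqs 0 (hz 0)).1
      rw [hq0] at this
      exact ball_subset_ball ((min_le_left _ _).trans (min_le_right _ _)) this
    · rw [mem_limsup_iff_frequently_mem, frequently_atTop]
      intro n
      have := (hqs n (hz n)).2
      simp only [Set.mem_iUnion] at this
      obtain ⟨i, hi, hzi⟩ := this
      exact ⟨i, hi, hzi⟩
  by_contra hne
  set H := Measure.mkMetric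
      (fun d : ℝ≥0∞ => ENNReal.ofReal (f d.toReal))
      (ball a ρ ∩ Filter.limsup (fun i => ball (x i) (r i)) atTop) with hH
  have hmt : m ≠ ⊤ := (hmlt.trans_le le_top).ne
  have hm1 : 0 < m.toNNReal := ENNReal.toNNReal_pos hm0 hmt
  have := main (m.toNNReal / (H.toNNReal + 1)) (by positivity)
  rw [ENNReal.div_le_iff_le_mul (Or.inl (by simpa using (ne_of_gt (by positivity)))) (Or.inl ENNReal.coe_ne_top)] at this
  rw [← ENNReal.coe_toNNReal hne, ← ENNReal.coe_mul] at this
  nth_rewrite 1 [← ENNReal.coe_toNNReal hmt] at this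
  rw [ENNReal.coe_le_coe, ← mul_div_assoc, le_div_iff₀ (by positivity)] at this
  rw [ENNReal.toNNReal_coe] at this
  nlinarith [this]
end core

lemma gauge_null_of_null {Y : Type*} [MetricSpace Y] [MeasurableSpace Y] [BorelSpace Y]
    (f g : ℝ → ℝ) (hf0 : Tendsto f (nhdsWithin 0 (Set.Ioi 0)) (nhds 0)) (t0 : ℝ) (ht0 : 0 < t0)
    (M : ℝ≥0)
    (hfg : ∀ u, 0 < u → u ≤ t0 → ENNReal.ofReal (f u) ≤ M * ENNReal.ofReal (g u))
    (noiso : ∀ y : Y, ∀ e > 0, ∃ z, z ≠ y ∧ dist z y < e) (N : Set Y)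
    (hN : Measure.mkMetric (fun d : ℝ≥0∞ => ENNReal.ofReal (g d.toReal)) N = 0) :
    Measure.mkMetric (fun d : ℝ≥0∞ => ENNReal.ofReal (f d.toReal)) N = 0 := by
  rw [Measure.mkMetric_apply] at hN ⊢
  simp only [ENNReal.iSup_eq_zero] at hN ⊢
  intro ρ hρ
  have h1 := hN (min ρ (ENNReal.ofReal t0)) (lt_min hρ (by simpa using ht0))
  set I := ⨅ (t : ℕ → Set Y) (_ : N ⊆ Set.iUnion t) (_ : ∀ n, ediam (t n) ≤ ρ),
    ∑' n, ⨆ _ : (t n).Nonempty, ENNReal.ofReal (f (ediam (t n)).toReal) with hI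
  have key : I / M ≤ 0 := by
    rw [← h1]
    refine le_iInf fun t => le_iInf fun htN => le_iInf fun htd => ?_
    apply ENNReal.div_le_of_le_mul'
    refine ENNReal.le_of_forall_pos_le_add fun ε hε _ => ?_
    obtain ⟨e, he, hesum⟩ := ENNReal.exists_pos_sum_of_countable (ε := ε) (by simpa using hε.ne') ℕ
    have hV : ∀ j, ∃ V : Set Y, t j ⊆ V ∧ ediam V ≤ ρ ∧
        (⨆ _ : V.Nonempty, ENNReal.ofReal (f (ediam V).toReal)) ≤
        M * (⨆ _ : (t j).Nonempty, ENNReal.ofReal (g (ediam (t j)).toReal)) + e j := by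
      intro j
      rcases (t j).eq_empty_or_nonempty with hemp | hne
      · exact ⟨∅, by rw [hemp], by simp, by simp⟩
      have hfin : ediam (t j) ≠ ⊤ :=
        ne_top_of_le_ne_top ENNReal.ofReal_ne_top ((htd j).trans (min_le_right _ _))
      rcases eq_or_ne (ediam (t j)) 0 with h0 | h0
      · obtain ⟨y, hy⟩ := hne
        have hsub : t j ⊆ {y} := by
          intro z hz
          exact (ediam_eq_zero_iff.1 h0) hz hy
        have hej : (0 : ℝ) < e j := by exact_mod_cast he j
        have ev1 := hf0.eventually (gt_mem_nhds hej)
        rw [eventually_nhdsWithin_iff, Metric.eventually_nhds_iff] at ev1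
        obtain ⟨b, hb, hb2⟩ := ev1
        obtain ⟨b', hb'0, hb'⟩ : ∃ b' : ℝ, 0 < b' ∧ ENNReal.ofReal b' ≤ ρ := by
          rcases eq_or_ne ρ ⊤ with ht | ht
          · exact ⟨1, one_pos, by simp [ht]⟩
          · exact ⟨ρ.toReal, ENNReal.toReal_pos hρ.ne' ht, by rw [ENNReal.ofReal_toReal ht]⟩
        obtain ⟨z, hzy, hz⟩ := noiso y (min b b') (lt_min hb hb'0)
        have hd : ediam {y, z} = ENNReal.ofReal (dist z y) := by
          rw [ediam_pair, edist_comm, edist_dist]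
        have hpos : 0 < dist z y := dist_pos.2 hzy
        refine ⟨{y, z}, hsub.trans (by simp), ?_, ?_⟩
        · rw [hd]
          exact (ENNReal.ofReal_le_ofReal (hz.le.trans (min_le_right _ _))).trans hb'
        · refine iSup_le fun _ => le_trans ?_ le_add_self
          rw [hd, ENNReal.toReal_ofReal hpos.le, ← ENNReal.ofReal_coe_nnreal]
          apply ENNReal.ofReal_le_ofReal
          refine (hb2 ?_ hpos).le
          rw [Real.dist_0_eq_abs, abs_of_pos hpos]
          exact hz.trans_le (min_le_left _ _)
      · refine ⟨t j, le_rfl, (htd j).trans (min_le_left _ _), ?_⟩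
        refine iSup_le fun _ => le_trans ?_ le_self_add
        rw [iSup_pos hne]
        refine hfg _ (ENNReal.toReal_pos h0 hfin) ?_
        exact ENNReal.toReal_le_of_le_ofReal ht0.le ((htd j).trans (min_le_right _ _))
    choose V hV1 hV2 hV3 using hV
    calc I ≤ ∑' n, ⨆ _ : (V n).Nonempty, ENNReal.ofReal (f (ediam (V n)).toReal) :=
          iInf_le_of_le V (iInf_le_of_le (htN.trans (Set.iUnion_mono hV1)) (iInf_le_of_le hV2 le_rfl))
      _ ≤ ∑' j, (M * (⨆ _ : (t j).Nonempty, ENNReal.ofReal (g (ediam (t j)).toReal)) + e j) :=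
          ENNReal.tsum_le_tsum hV3
      _ = M * (∑' j, ⨆ _ : (t j).Nonempty, ENNReal.ofReal (g (ediam (t j)).toReal)) +
            ∑' j, (e j : ℝ≥0∞) := by rw [ENNReal.tsum_add, ENNReal.tsum_mul_left]
      _ ≤ _ := by gcongr
  have := le_antisymm key bot_le
  rw [ENNReal.div_eq_zero_iff] at this
  exact this.resolve_right ENNReal.coe_ne_top

lemma full_of_full {Y : Type*} [MetricSpace Y] [MeasurableSpace Y] [BorelSpace Y]
    [SecondCountableTopology Y] (μ : Measure Y) [IsLocallyFiniteMeasure μ]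
    [IsUnifLocDoublingMeasure μ] (x : ℕ → Y) (r s : ℕ → ℝ) (hs : ∀ i, 0 < s i)
    (hs0 : Tendsto s atTop (nhds 0)) (full : ∀ᵐ y ∂μ, ∃ᶠ i in atTop, y ∈ ball (x i) (s i))
    (κ : ℝ≥0) (hκ : ∀ᶠ i in atTop, μ (closedBall (x i) (s i)) ≤
      κ * μ (closedBall (x i) (s i) ∩ ball (x i) (r i)))
    (hfin : ∀ᶠ i in atTop, μ (closedBall (x i) (s i)) ≠ 0 ∧ μ (closedBall (x i) (s i)) ≠ ⊤) :
    ∀ᵐ y ∂μ, ∃ᶠ i in atTop, y ∈ ball (x i) (r i) := by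
  have key : ∀ k : ℕ, μ {y | ∀ i ≥ k, y ∉ ball (x i) (r i)} = 0 := by
    intro k
    set S := {y | ∀ i ≥ k, y ∉ ball (x i) (r i)} with hS
    have hfalse : ∀ᵐ y ∂μ.restrict S, False := by
      filter_upwards [IsUnifLocDoublingMeasure.ae_tendsto_measure_inter_div.{_, 0} μ S 1,
        ae_restrict_of_ae full] with y hy hyf
      have : NeBot (atTop ⊓ 𝓟 {i | y ∈ ball (x i) (s i)}) := frequently_iff_neBot.1 hyf
      have ht := hy (l := atTop ⊓ 𝓟 {i | y ∈ ball (x i) (s i)}) x s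
        (tendsto_nhdsWithin_iff.2 ⟨hs0.mono_left inf_le_left, Eventually.of_forall hs⟩)
        (by
          filter_upwards [mem_inf_of_right (mem_principal_self _)] with i hi
          rw [one_mul]
          exact ball_subset_closedBall hi)
      have ht2 := (ENNReal.Tendsto.const_mul (a := (κ : ℝ≥0∞)) ht (Or.inl one_ne_zero)).add_const 1
      have hle : (κ : ℝ≥0∞) * 1 + 1 ≤ κ := by
        refine le_of_tendsto ht2 ?_
        filter_upwards [mem_inf_of_left hκ, mem_inf_of_left hfin,
          mem_inf_of_left (eventually_ge_atTop k)] with i h1 h2 h3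
        set B := closedBall (x i) (s i)
        have h4 : κ * μ (S ∩ B) + μ B ≤ κ * μ B := by
          calc κ * μ (S ∩ B) + μ B ≤ κ * μ (B \ ball (x i) (r i)) +
                κ * μ (B ∩ ball (x i) (r i)) := by
                gcongr
                rintro z ⟨z1, z2⟩
                exact ⟨z2, z1 i h3⟩
            _ = κ * (μ (B ∩ ball (x i) (r i)) + μ (B \ ball (x i) (r i))) := by ring
            _ = κ * μ B := by rw [measure_inter_add_sdiff _ isOpen_ball.measurableSet]
        calc κ * (μ (S ∩ B) / μ B) + 1 = (κ * μ (S ∩ B) + μ B) / μ B := by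
              rw [ENNReal.add_div, ENNReal.div_self h2.1 h2.2, mul_div_assoc]
          _ ≤ κ * μ B / μ B := by gcongr
          _ = κ := ENNReal.mul_div_cancel_right h2.1 h2.2
      rw [mul_one] at hle
      have : (κ + 1 : ℝ≥0) ≤ κ := by exact_mod_cast hle
      exact absurd this (by simp)
    rw [ae_iff] at hfalse
    simpa using hfalse
  have h2 : ∀ᵐ y ∂μ, ∀ k : ℕ, ¬ ∀ i ≥ k, y ∉ ball (x i) (r i) := by
    rw [ae_all_iff]
    intro k
    rw [ae_iff]
    simpa using key k
  filter_upwards [h2] with y hy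
  rw [frequently_atTop]
  intro k
  have := hy k
  push Not at this
  exact this

end mtpaux

open scoped ENNReal NNReal

/-- Beresnevich–Velani mass transference principle. Let `(Y, ρ)` be a
locally compact metric space and `g` a doubling dimension function with
`c₁ g r ≤ H^g (B(x, r)) ≤ c₂ g r` for all `x ∈ Y` and `0 < r ≤ r₀`. Let `(B_i)` be balls
`B(x_i, r_i)` with `r_i → 0`, and let `f` be a dimension function such that `f r / g r` is
monotonic; write `B^f = B(x, g⁻¹ (f r))`. If `H^g (B ∩ limsup B_i^f) = H^g B` for every ball
`B`, then `H^f (B ∩ limsup B_i) = H^f B` for every ball `B`. -/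
theorem mass_transference_principle
    {Y : Type*} [MetricSpace Y] [LocallyCompactSpace Y] [MeasurableSpace Y] [BorelSpace Y]
    (g : ℝ → ℝ) (hg : IsDimensionFunction g) (hgd : IsDoubling g)
    (c₁ c₂ r₀ : ℝ) (hc₁0 : 0 < c₁) (hc₁1 : c₁ < 1) (hc₂ : 1 < c₂) (hr₀ : 0 < r₀)
    (hcomp : ∀ (x : Y) (r : ℝ), 0 < r → r ≤ r₀ →
      ENNReal.ofReal (c₁ * g r) ≤ (gaugeHausdorff g : Measure Y) (ball x r) ∧
        (gaugeHausdorff g : Measure Y) (ball x r) ≤ ENNReal.ofReal (c₂ * g r))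
    (x : ℕ → Y) (r : ℕ → ℝ) (hr : ∀ i, 0 < r i) (hrlim : Tendsto r atTop (nhds 0))
    (f : ℝ → ℝ) (hf : IsDimensionFunction f)
    (hmono : MonotoneOn (fun t => f t / g t) (Set.Ioi 0)
      ∨ AntitoneOn (fun t => f t / g t) (Set.Ioi 0))
    (ginv : ℝ → ℝ) (hginv : ∀ t > 0, 0 < ginv t ∧ g (ginv t) = t)
    (hfull : ∀ (a : Y) (ρ : ℝ), 0 < ρ →
      (gaugeHausdorff g : Measure Y)
          (ball a ρ ∩ Filter.limsup (fun i => ball (x i) (ginv (f (r i)))) atTop)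
        = (gaugeHausdorff g : Measure Y) (ball a ρ)) :
    ∀ (a : Y) (ρ : ℝ), 0 < ρ →
      (gaugeHausdorff f : Measure Y)
          (ball a ρ ∩ Filter.limsup (fun i => ball (x i) (r i)) atTop)
        = (gaugeHausdorff f : Measure Y) (ball a ρ) := by
  intro a ρ hρ
  obtain ⟨hgc, hgm, hgp, hg0⟩ := hg
  obtain ⟨hfc, hfm, hfp, hf0⟩ := hf
  obtain ⟨η, hη1, hη⟩ := hgd
  set μ : Measure Y := gaugeHausdorff g with hμ
  set s : ℕ → ℝ := fun i => ginv (f (r i)) with hs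
  have spos : ∀ i, 0 < s i := fun i => (hginv _ (hfp _ (hr i))).1
  have gs : ∀ i, g (s i) = f (r i) := fun i => (hginv _ (hfp _ (hr i))).2
  have gmono : ∀ u v, 0 < u → u ≤ v → g u ≤ g v := fun u v hu huv =>
    hgm hu (hu.trans_le huv) huv
  have fmono : ∀ u v, 0 < u → u ≤ v → f u ≤ f v := fun u v hu huv =>
    hfm hu (hu.trans_le huv) huv
  have hfr : Tendsto (fun i => f (r i)) atTop (nhds 0) :=
    hf0.comp (tendsto_nhdsWithin_iff.2 ⟨hrlim, Eventually.of_forall hr⟩)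
  have s0 : Tendsto s atTop (nhds 0) := by
    rw [Metric.tendsto_nhds]
    intro e he
    filter_upwards [hfr.eventually (gt_mem_nhds (hgp e he))] with i hi
    rw [Real.dist_0_eq_abs, abs_of_pos (spos i)]
    by_contra hcon
    have := gmono e (s i) he (not_lt.1 hcon)
    rw [gs] at this
    linarith
  -- constants
  set c : ℝ := c₂ * η ^ 4 / c₁ with hc
  have hη4 : 1 < η ^ 4 := one_lt_pow₀ hη1 (by norm_num)
  have hηη4 : η ≤ η ^ 4 := le_self_pow₀ hη1.le (by norm_num)
  have hcc : c * c₁ = c₂ * η ^ 4 := by rw [hc]; field_simp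
  have hcc2 : c₂ * η ^ 4 ≤ c := by
    rw [hc, le_div_iff₀ hc₁0]
    have : 0 < c₂ * η ^ 4 := by positivity
    nlinarith
  have hc1 : 1 ≤ c := by nlinarith
  have hc0 : 0 ≤ c := by linarith
  set C : ℝ≥0 := c.toNNReal with hC
  have hCc : (C : ℝ≥0∞) = ENNReal.ofReal c := rfl
  have g16 : ∀ t, 0 < t → g (16 * t) ≤ η ^ 4 * g t := by
    intro t ht
    have e1 := hη t ht
    have e2 := hη (2 * t) (by positivity)
    have e3 := hη (2 * (2 * t)) (by positivity)
    have e4 := hη (2 * (2 * (2 * t))) (by positivity)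
    have hη0 : 0 ≤ η := by linarith
    calc g (16 * t) = g (2 * (2 * (2 * (2 * t)))) := by ring_nf
      _ ≤ η * (η * (η * (η * g t))) := by
          refine e4.trans (mul_le_mul_of_nonneg_left ?_ hη0)
          refine e3.trans (mul_le_mul_of_nonneg_left ?_ hη0)
          exact e2.trans (mul_le_mul_of_nonneg_left e1 hη0)
      _ = _ := by ring
  have low : ∀ y t, 0 < t → t ≤ r₀ / 16 →
      ENNReal.ofReal (g t) ≤ C * μ (ball y (t / 2)) := by
    intro y t ht htR
    have h1 := (hcomp y (t / 2) (by positivity) (by linarith)).1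
    refine le_trans ?_ (mul_le_mul' le_rfl h1)
    rw [hCc, ← ENNReal.ofReal_mul hc0]
    apply ENNReal.ofReal_le_ofReal
    have h2 := hη (t / 2) (by positivity)
    have h3 := hgp (t / 2) (by positivity)
    rw [show 2 * (t / 2) = t by ring] at h2
    rw [← mul_assoc, hcc]
    refine h2.trans (mul_le_mul_of_nonneg_right ?_ h3.le)
    nlinarith
  have up : ∀ y t, 0 < t → t ≤ r₀ / 16 →
      μ (closedBall y (8 * t)) ≤ C * ENNReal.ofReal (g t) := by
    intro y t ht htR
    have h1 := (hcomp y (16 * t) (by positivity) (by linarith)).2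
    refine (measure_mono (closedBall_subset_ball (by linarith))).trans (h1.trans ?_)
    rw [hCc, ← ENNReal.ofReal_mul hc0]
    apply ENNReal.ofReal_le_ofReal
    have h2 := g16 t ht
    have h3 := hgp t ht
    calc c₂ * g (16 * t) ≤ c₂ * (η ^ 4 * g t) := by gcongr
      _ = (c₂ * η ^ 4) * g t := by ring
      _ ≤ c * g t := by gcongr
  have hR : 0 < r₀ / 16 := by positivity
  have ballpos : ∀ (y : Y) t, 0 < t → 0 < μ (ball y t) := by
    intro y t ht
    have h1 := (hcomp y (min t r₀) (lt_min ht hr₀) (min_le_right _ _)).1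
    have h2 : 0 < ENNReal.ofReal (c₁ * g (min t r₀)) := by
      have := hgp _ (lt_min ht hr₀)
      simp only [ENNReal.ofReal_pos]
      positivity
    exact h2.trans_le (h1.trans (measure_mono (ball_subset_ball (min_le_left _ _))))
  -- separability
  have hdense : Dense (Set.range x) := by
    rw [Metric.dense_iff]
    intro y e he
    have h1 := hfull y (e / 2) (by positivity)
    have h2 : 0 < μ (ball y (e / 2) ∩ Filter.limsup (fun i => ball (x i) (s i)) atTop) := by
      rw [h1]; exact ballpos y _ (by positivity)
    obtain ⟨z, hz1, hz2⟩ := nonempty_of_measure_ne_zero h2.ne'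
    rw [mem_limsup_iff_frequently_mem] at hz2
    obtain ⟨i, hi1, hi2⟩ := (hz2.and_eventually
      (s0.eventually (gt_mem_nhds (show 0 < e / 2 by positivity)))).exists
    refine ⟨x i, ?_, i, rfl⟩
    simp only [mem_ball] at *
    linarith [dist_triangle_left (x i) y z]
  have : TopologicalSpace.SeparableSpace Y := ⟨⟨_, Set.countable_range x, hdense⟩⟩
  have : SecondCountableTopology Y := UniformSpace.secondCountable_of_separable Y
  have ballfin : ∀ (y : Y) t, 0 < t → t ≤ r₀ → μ (ball y t) ≠ ⊤ := fun y t h1 h2 =>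
    ne_top_of_le_ne_top ENNReal.ofReal_ne_top (hcomp y t h1 h2).2
  have : IsLocallyFiniteMeasure μ :=
    ⟨fun y => ⟨ball y r₀, ball_mem_nhds y hr₀, (ballfin y r₀ hr₀ le_rfl).lt_top⟩⟩
  -- full measure
  have hmeas : MeasurableSet (Filter.limsup (fun i => ball (x i) (s i)) atTop) :=
    MeasurableSet.measurableSet_limsup fun i => isOpen_ball.measurableSet
  have full : ∀ᵐ y ∂μ, ∃ᶠ i in atTop, y ∈ ball (x i) (s i) := by
    have : μ (Filter.limsup (fun i => ball (x i) (s i)) atTop)ᶜ = 0 := by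
      apply measure_null_of_locally_null
      intro y _
      refine ⟨ball y r₀ ∩ (Filter.limsup (fun i => ball (x i) (s i)) atTop)ᶜ, ?_, ?_⟩
      · rw [Set.inter_comm]
        exact inter_mem_nhdsWithin _ (ball_mem_nhds y hr₀)
      · have h1 := measure_inter_add_sdiff (μ := μ) (ball y r₀) hmeas
        rw [hfull y r₀ hr₀] at h1
        rw [← Set.diff_eq]
        have h2 := ballfin y r₀ hr₀ le_rfl
        nth_rewrite 2 [← add_zero (μ (ball y r₀))] at h1
        exact (ENNReal.add_right_inj h2).1 h1
    have h3 := compl_mem_ae_iff.2 this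
    rw [compl_compl] at h3
    filter_upwards [h3] with y hy
    exact mem_limsup_iff_frequently_mem.1 hy
  have hsR : ∀ᶠ i in atTop, s i ≤ r₀ / 16 := by
    filter_upwards [s0.eventually (gt_mem_nhds hR)] with i hi using hi.le
  have hrR : ∀ᶠ i in atTop, r i ≤ r₀ / 16 := by
    filter_upwards [hrlim.eventually (gt_mem_nhds hR)] with i hi using hi.le
  by_cases hbdd : ∃ M : ℝ, ∃ t0 > 0, ∀ u, 0 < u → u ≤ t0 → f u ≤ M * g u
  · -- bounded ratio
    obtain ⟨M, t0, ht0, hM⟩ := hbdd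
    set M' : ℝ := max M 1 with hM'
    have hM'1 : 1 ≤ M' := le_max_right _ _
    have hM2 : ∀ u, 0 < u → u ≤ t0 → f u ≤ M' * g u := fun u h1 h2 =>
      (hM u h1 h2).trans (mul_le_mul_of_nonneg_right (le_max_left _ _) (hgp u h1).le)
    have : IsUnifLocDoublingMeasure μ := by
      refine ⟨⟨C * C, ?_⟩⟩
      have : ∀ᶠ e in nhdsWithin (0 : ℝ) (Set.Ioi 0), e < r₀ / 16 :=
        nhdsWithin_le_nhds (gt_mem_nhds hR)
      filter_upwards [this, self_mem_nhdsWithin] with e he1 he0 y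
      have he0 : 0 < e := he0
      calc μ (closedBall y (2 * e)) ≤ μ (closedBall y (8 * e)) :=
            measure_mono (closedBall_subset_closedBall (by linarith))
        _ ≤ C * ENNReal.ofReal (g e) := up y e he0 he1.le
        _ ≤ C * (C * μ (ball y (e / 2))) := mul_le_mul' le_rfl (low y e he0 he1.le)
        _ ≤ C * (C * μ (closedBall y e)) := by
            gcongr
            exact ball_subset_closedBall.trans (closedBall_subset_closedBall (by linarith))
        _ = _ := by push_cast; ring
    have hfull2 := full_of_full μ x r s spos s0 full (C * C * M'.toNNReal) (by
        filter_upwards [hsR, hrR, hrlim.eventually (gt_mem_nhds ht0)] with i h1 h2 h3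
        have hmin : 0 < min (r i) (s i) := lt_min (hr i) (spos i)
        have hgmin : g (s i) ≤ M' * g (min (r i) (s i)) := by
          rcases min_choice (r i) (s i) with hh | hh
          · rw [hh, gs]; exact hM2 _ (hr i) h3.le
          · rw [hh]; nlinarith [hgp _ (spos i)]
        calc μ (closedBall (x i) (s i)) ≤ μ (closedBall (x i) (8 * s i)) :=
              measure_mono (closedBall_subset_closedBall (by linarith [spos i]))
          _ ≤ C * ENNReal.ofReal (g (s i)) := up _ _ (spos i) h1
          _ ≤ C * (M'.toNNReal * ENNReal.ofReal (g (min (r i) (s i)))) := by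
              gcongr
              have : ((M'.toNNReal : ℝ≥0) : ℝ≥0∞) = ENNReal.ofReal M' := rfl
              rw [this, ← ENNReal.ofReal_mul (by linarith)]
              exact ENNReal.ofReal_le_ofReal hgmin
          _ ≤ C * (M'.toNNReal * (C * μ (ball (x i) (min (r i) (s i) / 2)))) := by
              gcongr
              exact low _ _ hmin ((min_le_right _ _).trans h1)
          _ ≤ C * (M'.toNNReal * (C * μ (closedBall (x i) (s i) ∩ ball (x i) (r i)))) := by
              gcongr
              have e1 := min_le_left (r i) (s i)
              have e2 := min_le_right (r i) (s i)
              refine Set.subset_inter (ball_subset_closedBall.trans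
                (closedBall_subset_closedBall (by linarith))) (ball_subset_ball (by linarith))
          _ = _ := by push_cast; ring) (by
        filter_upwards [hsR] with i h1
        refine ⟨((ballpos (x i) (s i) (spos i)).trans_le (measure_mono ball_subset_closedBall)).ne',
          ne_top_of_le_ne_top (ballfin (x i) (2 * s i) (by linarith [spos i]) (by linarith))
            (measure_mono (closedBall_subset_ball (by linarith [spos i])))⟩)
    have hnull : μ (Filter.limsup (fun i => ball (x i) (r i)) atTop)ᶜ = 0 := by
      rw [← compl_mem_ae_iff, compl_compl]
      filter_upwards [hfull2] with y hy
      exact mem_limsup_iff_frequently_mem.2 hy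
    have noiso : ∀ y : Y, ∀ e > 0, ∃ z, z ≠ y ∧ dist z y < e := by
      intro y e he
      by_contra hcon
      push Not at hcon
      set d := min e r₀ with hd
      have hd0 : 0 < d := lt_min he hr₀
      have hgd : 0 < c₁ * g d / c₂ := by have := hgp d hd0; positivity
      have e1 : ∀ᶠ t in nhdsWithin (0 : ℝ) (Set.Ioi 0), t < d :=
        nhdsWithin_le_nhds (gt_mem_nhds hd0)
      obtain ⟨t, ht1, ht2, ht3⟩ := ((hg0.eventually (gt_mem_nhds hgd)).and
        (e1.and self_mem_nhdsWithin)).exists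
      have ht3 : 0 < t := ht3
      have hsub : ball y d ⊆ ball y t := by
        intro z hz
        by_cases hzy : z = y
        · rw [hzy]; exact mem_ball_self ht3
        · have := hcon z hzy
          rw [mem_ball] at hz
          linarith [min_le_left e r₀]
      have h1 := ((hcomp y d hd0 (min_le_right _ _)).1.trans (measure_mono hsub)).trans
        (hcomp y t ht3 (ht2.le.trans (min_le_right _ _))).2
      rw [ENNReal.ofReal_le_ofReal_iff (by have := hgp t ht3; positivity)] at h1
      rw [lt_div_iff₀ (by linarith)] at ht1
      linarith
    have hnull2 : (gaugeHausdorff f : Measure Y)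
        (Filter.limsup (fun i => ball (x i) (r i)) atTop)ᶜ = 0 := by
      refine gauge_null_of_null f g hf0 t0 ht0 M'.toNNReal ?_ noiso _ hnull
      intro u h1 h2
      have : ((M'.toNNReal : ℝ≥0) : ℝ≥0∞) = ENNReal.ofReal M' := rfl
      rw [this, ← ENNReal.ofReal_mul (by linarith)]
      exact ENNReal.ofReal_le_ofReal (hM2 u h1 h2)
    exact measure_inter_conull hnull2
  · -- unbounded ratio
    push Not at hbdd
    have hanti : AntitoneOn (fun t => f t / g t) (Set.Ioi 0) := by
      rcases hmono with hm | hm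
      · exfalso
        obtain ⟨u, h1, h2, h3⟩ := hbdd (f 1 / g 1) 1 one_pos
        have h4 := hm (show u ∈ Set.Ioi (0 : ℝ) from h1) (show (1 : ℝ) ∈ Set.Ioi (0 : ℝ) from Set.mem_Ioi.2 one_pos) h2
        dsimp only at h4
        rw [div_le_iff₀ (hgp u h1)] at h4
        linarith
      · exact hm
    have hunb : ∀ M : ℝ, ∃ t0 > 0, ∀ u, 0 < u → u ≤ t0 → M * g u ≤ f u := by
      intro M
      obtain ⟨v, h1, h2, h3⟩ := hbdd M 1 one_pos
      refine ⟨v, h1, fun u hu huv => ?_⟩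
      have h4 := hanti (show u ∈ Set.Ioi (0 : ℝ) from hu) (show v ∈ Set.Ioi (0 : ℝ) from h1) huv
      dsimp only at h4
      rw [← lt_div_iff₀ (hgp v h1)] at h3
      rw [← le_div_iff₀ (hgp u hu)]
      linarith
    have data : MTPData μ (fun u => ENNReal.ofReal (f u)) (fun u => ENNReal.ofReal (g u)) C
        (r₀ / 16) x r s :=
      { R_pos := hR
        C_one := by rw [hC, Real.one_le_toNNReal]; exact hc1
        low := low
        up := up
        Fmono := fun u v h1 h2 => ENNReal.ofReal_le_ofReal (fmono u v h1 h2)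
        Gmono := fun u v h1 h2 => ENNReal.ofReal_le_ofReal (gmono u v h1 h2)
        Ffin := fun u => ENNReal.ofReal_ne_top
        Gfin := fun u => ENNReal.ofReal_ne_top
        Fpos := fun u hu => by simpa using hfp u hu
        Gpos := fun u hu => by simpa using hgp u hu
        anti := by
          intro u v hu huv
          have hv : 0 < v := hu.trans_le huv
          have h4 := hanti (show u ∈ Set.Ioi (0 : ℝ) from hu) (show v ∈ Set.Ioi (0 : ℝ) from hv) huv
          dsimp only at h4
          rw [div_le_div_iff₀ (hgp v hv) (hgp u hu)] at h4
          rw [← ENNReal.ofReal_mul (hfp v hv).le, ← ENNReal.ofReal_mul (hfp u hu).le]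
          exact ENNReal.ofReal_le_ofReal h4
        unb := by
          intro M
          obtain ⟨t0, ht0, h⟩ := hunb M
          refine ⟨t0, ht0, fun u h1 h2 => ?_⟩
          rw [← ENNReal.ofReal_coe_nnreal, ← ENNReal.ofReal_mul M.coe_nonneg]
          exact ENNReal.ofReal_le_ofReal (h u h1 h2)
        unif := by
          intro δ b κ hδ hκ
          have huc : UniformContinuousOn f (Set.Icc δ (b + 1)) :=
            isCompact_Icc.uniformContinuousOn_of_continuous
              (hfc.mono fun z hz => hδ.trans_le hz.1)
          rw [Metric.uniformContinuousOn_iff] at huc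
          have hfδ := hfp δ hδ
          obtain ⟨τ, hτ, h⟩ := huc ((κ - 1) * f δ) (mul_pos (by linarith) hfδ)
          refine ⟨min (τ / 2) 1, by positivity, fun τ' u h1 h2 h3 h4 => ?_⟩
          have e1 := min_le_left (τ / 2) 1
          have e2 := min_le_right (τ / 2) 1
          have h5 := h (u + τ') ⟨by linarith, by linarith⟩ u ⟨h3, by linarith⟩
            (by rw [Real.dist_eq, add_sub_cancel_left, abs_of_pos h1]; linarith)
          rw [Real.dist_eq] at h5
          have h6 := (abs_lt.1 h5).2
          have h7 := fmono δ u hδ h3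
          rw [← ENNReal.ofReal_mul (by linarith)]
          apply ENNReal.ofReal_le_ofReal
          nlinarith
        rpos := hr
        spos := spos
        rs := by
          obtain ⟨t0, ht0, h⟩ := hunb 2
          filter_upwards [hrlim.eventually (gt_mem_nhds ht0)] with i hi
          by_contra hcon
          have h1 := gmono (s i) (r i) (spos i) (not_le.1 hcon).le
          have h2 := h (r i) (hr i) hi.le
          have h3 := hgp _ (hr i)
          rw [gs] at h1
          linarith
        s0 := s0
        Gs := fun i => by rw [gs]
        full := full }
    have htop := data.top hfc hf0 a ρ hρ
    have htop' : (gaugeHausdorff f : Measure Y)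
        (ball a ρ ∩ Filter.limsup (fun i => ball (x i) (r i)) atTop) = ⊤ := htop
    rw [htop']
    symm
    rw [← top_le_iff, ← htop']
    exact measure_mono Set.inter_subset_left
end

section
/- Let (X,𝓑,μ,T,d) be an exponentially mixing metric measure-preserving system on a compact metric space with μ Ahlfors s-regular, and let (l_n)_{n≥0} be positive reals decreasing to 0. Then for μ-almost every x ∈ X, the dynamical covering set E(x,l_n) is residual in X (its complement is of first category) and is itself a set of second category. -/
open MeasureTheory Metric Filter

/-- A metric measure-preserving system `(X, μ, T)` is *exponentially mixing* (with constants
`c > 0`, `0 < γ < 1`) if `|μ(A ∩ T⁻ⁿF)/μ(F) - μ(A)| ≤ c γ^n` for every `n ≥ 1`, every ball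
`A = B(y,ρ)` and every measurable `F` with `μ F > 0`. -/
def IsExpMixingSystem {X : Type*} [MetricSpace X] [MeasurableSpace X]
    (μ : Measure X) (T : X → X) (c γ : ℝ) : Prop :=
  ∀ n : ℕ, 1 ≤ n → ∀ (y : X) (ρ : ℝ) (F : Set X), MeasurableSet F → 0 < μ F →
    |(μ (ball y ρ ∩ T^[n] ⁻¹' F)).toReal / (μ F).toReal - (μ (ball y ρ)).toReal| ≤ c * γ ^ n

theorem aux_ball_pos {X : Type*} [MetricSpace X] [CompactSpace X] [MeasurableSpace X]
    (μ : Measure X) [IsProbabilityMeasure μ] (s : ℝ) (hreg : IsAhlforsRegular μ s)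
    (x : X) (r : ℝ) (hr : 0 < r) : 0 < μ (ball x r) := by
  obtain ⟨C, hC, h⟩ := hreg
  have hb : Bornology.IsBounded (Set.univ : Set X) := isCompact_univ.isBounded
  rcases (diam_nonneg (s := (Set.univ : Set X))).eq_or_lt with h0 | h0
  · have : ball x r = Set.univ := by
      ext y
      have := dist_le_diam_of_mem hb (Set.mem_univ y) (Set.mem_univ x)
      simp only [mem_ball, Set.mem_univ, iff_true]
      linarith
    rw [this]; simp
  · have hm : 0 < min r (diam (Set.univ : Set X)) := lt_min hr h0
    have h1 := (h x _ hm (min_le_right _ _)).1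
    have h2 : 0 < ENNReal.ofReal (C⁻¹ * (min r (diam (Set.univ : Set X))) ^ s) := by
      rw [ENNReal.ofReal_pos]
      have := Real.rpow_pos_of_pos hm s
      positivity
    exact (h2.trans_le h1).trans_le (measure_mono (ball_subset_ball (min_le_left _ _)))

theorem aux_avoid {X : Type*} [MetricSpace X] [MeasurableSpace X] [BorelSpace X]
    (μ : Measure X) [IsProbabilityMeasure μ]
    (T : X → X) (hT : Measurable T) (hpres : MeasurePreserving T μ μ)
    (c γ : ℝ) (hγ0 : 0 < γ) (hγ1 : γ < 1)
    (hmix : IsExpMixingSystem μ T c γ) (y : X) (r : ℝ) (hpos : 0 < μ (ball y r)) (m : ℕ) :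
    ∀ᵐ x ∂μ, ∃ n, m ≤ n ∧ T^[n] x ∈ ball y r := by
  set G : Set X := ⋂ n : ℕ, T^[n] ⁻¹' (ball y r)ᶜ with hG
  have hGm : MeasurableSet G :=
    MeasurableSet.iInter fun n => (hT.iterate n) measurableSet_ball.compl
  have hG0 : μ G = 0 := by
    by_contra hne
    have hGpos : 0 < μ G := pos_iff_ne_zero.2 hne
    have key : ∀ n : ℕ, μ (ball y r ∩ T^[n] ⁻¹' G) = 0 := by
      intro n
      have hpre : μ (T^[n] ⁻¹' G) = μ G :=
        (hpres.iterate n).measure_preimage hGm.nullMeasurableSet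
      have hsub : G ⊆ T^[n] ⁻¹' G := by
        intro x hx
        simp only [hG, Set.mem_iInter, Set.mem_preimage] at hx ⊢
        intro k
        rw [← Function.iterate_add_apply]
        exact hx _
      have hd : μ (T^[n] ⁻¹' G \ G) = 0 := by
        rw [measure_diff hsub hGm.nullMeasurableSet (measure_ne_top _ _), hpre, tsub_self]
      refine measure_mono_null ?_ hd
      rintro x ⟨hx, hx'⟩
      refine ⟨hx', fun hxG => ?_⟩
      exact (Set.mem_iInter.1 hxG 0) hx
    have hlim : Tendsto (fun n : ℕ => c * γ ^ n) atTop (nhds 0) := by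
      simpa using (tendsto_pow_atTop_nhds_zero_of_lt_one hγ0.le hγ1).const_mul c
    have hp : 0 < (μ (ball y r)).toReal := ENNReal.toReal_pos hpos.ne' (measure_ne_top _ _)
    have hle : (μ (ball y r)).toReal ≤ 0 := by
      refine ge_of_tendsto hlim ?_
      filter_upwards [eventually_ge_atTop 1] with n hn
      have := hmix n hn y r G hGm hGpos
      rw [key n] at this
      simpa using this
    linarith
  have hFm : μ (T^[m] ⁻¹' G) = 0 := by
    rw [(hpres.iterate m).measure_preimage hGm.nullMeasurableSet, hG0]
  refine measure_mono_null ?_ hFm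
  intro x hx
  simp only [Set.mem_compl_iff, Set.mem_setOf_eq, not_exists, not_and] at hx
  simp only [hG, Set.mem_iInter, Set.mem_preimage]
  intro k
  rw [← Function.iterate_add_apply]
  exact hx _ (by omega)

/-- dynamical Theorem 4. For an exponentially mixing metric
measure-preserving system `(X, μ, T)` with `μ` Ahlfors `s`-regular and `(l n)` decreasing to
`0`, for `μ`-a.e. `x` the dynamical covering set `E(x) = limsup B(T^n x, l n)` is residual
(its complement is of first category) and is itself of second category (not meager). -/
theorem dynamical_covering_residual_second_category
    {X : Type*} [MetricSpace X] [CompactSpace X] [MeasurableSpace X] [BorelSpace X]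
    (μ : Measure X) [IsProbabilityMeasure μ]
    (s : ℝ) (hs : 0 < s) (hreg : IsAhlforsRegular μ s)
    (T : X → X) (hT : Measurable T) (hpres : MeasurePreserving T μ μ)
    (c γ : ℝ) (hc : 0 < c) (hγ0 : 0 < γ) (hγ1 : γ < 1)
    (hmix : IsExpMixingSystem μ T c γ)
    (l : ℕ → ℝ) (hpos : ∀ n, 0 < l n) (hanti : Antitone l)
    (hlim : Tendsto l atTop (nhds 0)) :
    ∀ᵐ x ∂μ, IsMeagre (Filter.limsup (fun n => ball (T^[n] x) (l n)) atTop)ᶜ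
      ∧ ¬ IsMeagre (Filter.limsup (fun n => ball (T^[n] x) (l n)) atTop) := by
  have hne : Nonempty X := by
    by_contra h
    rw [not_nonempty_iff] at h
    have h1 : μ Set.univ = 1 := measure_univ
    rw [Set.univ_eq_empty_iff.2 h] at h1
    simp at h1
  have hae : ∀ᵐ x ∂μ, ∀ (i k m : ℕ), ∃ n, m ≤ n ∧
      T^[n] x ∈ ball (TopologicalSpace.denseSeq X i) (1 / ((k : ℝ) + 1)) := by
    simp only [ae_all_iff]
    intro i k m
    exact aux_avoid μ T hT hpres c γ hγ0 hγ1 hmix _ _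
      (aux_ball_pos μ s hreg _ _ (by positivity)) m
  filter_upwards [hae] with x hx
  have hlimsup : Filter.limsup (fun n => ball (T^[n] x) (l n)) atTop
      = ⋂ m : ℕ, ⋃ n ≥ m, ball (T^[n] x) (l n) := by
    rw [limsup_eq_iInf_iSup_of_nat]
    rfl
  have hres : Filter.limsup (fun n => ball (T^[n] x) (l n)) atTop ∈ residual X := by
    rw [hlimsup, countable_iInter_mem]
    intro m
    refine residual_of_dense_open
      (isOpen_iUnion fun n => isOpen_iUnion fun _ => isOpen_ball) ?_
    rw [Metric.dense_iff]
    intro z r hr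
    obtain ⟨k, hk⟩ := exists_nat_one_div_lt (half_pos hr)
    obtain ⟨w, hw, i, rfl⟩ := Metric.dense_iff.1 (TopologicalSpace.denseRange_denseSeq X) z
      (r / 2) (half_pos hr)
    obtain ⟨n, hn, hxn⟩ := hx i k m
    refine ⟨T^[n] x, ?_, ?_⟩
    · rw [mem_ball] at hw hxn ⊢
      have := dist_triangle (T^[n] x) (TopologicalSpace.denseSeq X i) z
      linarith
    · simp only [Set.mem_iUnion]
      exact ⟨n, hn, mem_ball_self (hpos n)⟩
  refine ⟨?_, ?_⟩
  · rw [IsMeagre, compl_compl]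
    exact hres
  · intro hm
    have h := Filter.inter_mem hres hm
    rw [Set.inter_compl_self] at h
    obtain ⟨z, hz⟩ := (dense_of_mem_residual h).nonempty
    exact hz
end
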